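/- arXiv:2212.08630 — 2 statements merged into one kernel-verified Lean document; each statement's English description precedes it below -/
import Mathlib

section
/- Let n ≥ 1 and k, l ≥ 0 be integers with l + k even. Then the set {E_β : β a (k,l)-Brauer partition} spans the vector space Hom_{O(n)}((ℝⁿ)^{⊗k},(ℝⁿ)^{⊗l}) of O(n)-equivariant linear maps; in particular this space has dimension at most (l+k−1)!! = (l+k−1)(l+k−3)⋯3·1. -/
open Matrix

noncomputable section

/-- The matrix of `g^{⊗k}` in the standard basis of `(ℝⁿ)^{⊗k}`. -/
def tpowM {n : ℕ} (k : ℕ) (g : Matrix (Fin n) (Fin n) ℝ) :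
    Matrix (Fin k → Fin n) (Fin k → Fin n) ℝ :=
  Matrix.of fun I J => ∏ r, g (I r) (J r)

/-- The subspace `Hom_G((ℝⁿ)^{⊗k}, (ℝⁿ)^{⊗l})` of linear maps equivariant under
all matrices satisfying `P`. -/
def EquivSub {n : ℕ} (k l : ℕ) (P : Matrix (Fin n) (Fin n) ℝ → Prop) :
    Submodule ℝ (((Fin k → Fin n) → ℝ) →ₗ[ℝ] ((Fin l → Fin n) → ℝ)) where
  carrier := {φ | ∀ g : Matrix (Fin n) (Fin n) ℝ, P g →
    φ ∘ₗ (tpowM k g).mulVecLin = (tpowM l g).mulVecLin ∘ₗ φ}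
  add_mem' := by
    intro φ ψ hφ hψ g hg
    rw [LinearMap.add_comp, LinearMap.comp_add, hφ g hg, hψ g hg]
  zero_mem' := by
    intro g hg
    rw [LinearMap.zero_comp, LinearMap.comp_zero]
  smul_mem' := by
    intro c φ hφ g hg
    rw [LinearMap.smul_comp, LinearMap.comp_smul, hφ g hg]

/-- A partition of `{1, …, N}` into disjoint pairs (a perfect matching),
encoded as a fixed-point-free involution: the blocks are the sets `{p, pair p}`. -/
structure BrauerPairing (N : ℕ) where
  pair : Fin N → Fin N
  invol : ∀ p, pair (pair p) = p
  ne : ∀ p, pair p ≠ p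

/-- The matrix `E_β` of a `(k,l)`-Brauer partition `β`. -/
def brauerMatrix (n k l : ℕ) (β : BrauerPairing (l + k)) :
    Matrix (Fin l → Fin n) (Fin k → Fin n) ℝ :=
  Matrix.of fun I J =>
    ∏ p ∈ Finset.univ.filter (fun p => p < β.pair p),
      if Fin.append I J p = Fin.append I J (β.pair p) then (1 : ℝ) else 0

open MeasureTheory ProbabilityTheory

/-- The indicator tensor of a pairing. -/
def bdelta {N : ℕ} {ι : Type} [DecidableEq ι] (β : BrauerPairing N) (c : Fin N → ι) : ℝ :=
  if ∀ p, c p = c (β.pair p) then 1 else 0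

/-- Extend a pairing by pairing `0` with `s.succ`. -/
def bext {N : ℕ} (s : Fin (N + 1)) (β : BrauerPairing N) : BrauerPairing (N + 2) where
  pair := Fin.cons s.succ (Fin.insertNth (α := fun _ => Fin (N + 2)) s 0
    (fun q => (s.succAbove (β.pair q)).succ))
  invol := by
    intro p
    refine Fin.cases ?_ (fun p => ?_) p
    · simp
    · refine Fin.succAboveCases s ?_ (fun q => ?_) p
      · simp
      · simp [β.invol]
  ne := by
    intro p
    refine Fin.cases ?_ (fun p => ?_) p
    · simp
    · refine Fin.succAboveCases s ?_ (fun q => ?_) p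
      · simpa using (Fin.succ_ne_zero s).symm
      · simp [β.ne]

lemma bdelta_bext {N : ℕ} {ι : Type} [DecidableEq ι] (s : Fin (N + 1)) (β : BrauerPairing N)
    (c : Fin (N + 2) → ι) :
    bdelta (bext s β) c =
      if c 0 = c s.succ then bdelta β (fun q => c (s.succAbove q).succ) else 0 := by
  unfold bdelta
  rw [← ite_and]
  congr 1
  rw [eq_iff_iff, Fin.forall_fin_succ]
  rw [Fin.forall_iff_succAbove s]
  simp only [bext, Fin.cons_zero, Fin.cons_succ, Fin.insertNth_apply_same,
    Fin.insertNth_apply_succAbove]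
  tauto

/-- Gaussian moments. -/
def gmom (k : ℕ) : ℝ := ∫ x, x ^ k ∂(gaussianReal 0 1)

lemma gint (k : ℕ) : Integrable (fun x : ℝ => x ^ k) (gaussianReal 0 1) := by
  have h := (memLp_id_gaussianReal (μ := 0) (v := 1) (k : NNReal)).integrable_norm_pow'
  rw [← integrable_norm_iff (by fun_prop)]
  simpa using h

lemma gmom_zero : gmom 0 = 1 := by simp [gmom]

lemma gmom_one : gmom 1 = 0 := by simp [gmom]

lemma vint (k : ℕ) : Integrable (fun x : ℝ => x ^ k * gaussianPDFReal 0 1 x) := by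
  have h := integrable_rpow_mul_exp_neg_mul_sq (b := 1/2) (by norm_num) (s := (k : ℝ))
    (by have : (0:ℝ) ≤ k := by positivity
        linarith)
  have h2 := h.const_mul (√(2 * Real.pi))⁻¹
  refine h2.congr (Filter.Eventually.of_forall fun x => ?_)
  simp only [gaussianPDFReal, Real.rpow_natCast, NNReal.coe_one, mul_one, sub_zero]
  rw [show -(1/2) * x^2 = -x^2/2 by ring]
  ring

lemma gmom_succ (k : ℕ) : gmom (k + 1) = k * gmom (k - 1) := by
  rcases k with _ | k
  · simp [gmom_one]
  have hd : ∀ x : ℝ, HasDerivAt (gaussianPDFReal 0 1) (-(x * gaussianPDFReal 0 1 x)) x := by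
    intro x
    have : gaussianPDFReal 0 1 = fun x => (√(2 * Real.pi))⁻¹ * Real.exp (-x^2/2) := by
      ext x
      simp [gaussianPDFReal]
    rw [this]
    have h1 : HasDerivAt (fun x : ℝ => -x^2/2) (-x) x := by
      have := ((hasDerivAt_pow 2 x).neg).div_const 2
      refine this.congr_deriv ?_
      norm_num
      ring
    have h2 := h1.exp.const_mul (√(2 * Real.pi))⁻¹
    refine h2.congr_deriv ?_
    ring
  have key := integral_mul_deriv_eq_deriv_mul_of_integrable
    (u := fun x : ℝ => x ^ (k + 1)) (u' := fun x => ((k + 1 : ℕ) : ℝ) * x ^ k)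
    (v := gaussianPDFReal 0 1) (v' := fun x => -(x * gaussianPDFReal 0 1 x))
    (fun x _ => by simpa using hasDerivAt_pow (k + 1) x) (fun x _ => hd x)
    (by
      refine (vint (k + 2)).neg.congr (Filter.Eventually.of_forall fun x => ?_)
      simp
      ring)
    (by
      refine ((vint k).const_mul ((k + 1 : ℕ) : ℝ)).congr (Filter.Eventually.of_forall fun x => ?_)
      simp
      ring)
    (vint (k + 1))
  simp only [gmom, integral_gaussianReal_eq_integral_smul one_ne_zero, smul_eq_mul,
    Nat.add_sub_cancel]
  rw [← integral_const_mul]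
  have e1 : ∀ x : ℝ, x ^ (k + 1) * -(x * gaussianPDFReal 0 1 x) =
    - (gaussianPDFReal 0 1 x * x ^ (k + 1 + 1)) := fun x => by ring
  simp_rw [e1] at key
  rw [integral_neg, neg_inj] at key
  rw [key]
  congr 1
  ext x
  ring

/-- Number of occurrences. -/
def cnt {N : ℕ} {ι : Type} [DecidableEq ι] (c : Fin N → ι) (a : ι) : ℕ :=
  ∑ r, if c r = a then 1 else 0

/-- Joint Gaussian moments. -/
def jmom {N : ℕ} {ι : Type} [DecidableEq ι] [Fintype ι] (c : Fin N → ι) : ℝ :=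
  ∏ a, gmom (cnt c a)

lemma jmom_rec {N : ℕ} {ι : Type} [DecidableEq ι] [Fintype ι] (c : Fin (N + 2) → ι) :
    jmom c = ∑ s : Fin (N + 1), if c 0 = c s.succ then
      jmom (fun q => c (s.succAbove q).succ) else 0 := by
  set c' : Fin (N + 1) → ι := fun s => c s.succ with hc'
  have h1 : ∀ b, cnt c b = (if c 0 = b then 1 else 0) + cnt c' b := by
    intro b
    simp [cnt, Fin.sum_univ_succ (n := N + 1), hc']
  have h2 : ∀ s b, cnt c' b = (if c' s = b then 1 else 0) +
      cnt (fun q => c' (s.succAbove q)) b := by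
    intro s b
    simp only [cnt]
    rw [Fin.sum_univ_succAbove _ s]
  set P : ℝ := ∏ b ∈ Finset.univ.erase (c 0), gmom (cnt c' b) with hP
  have h3 : jmom c = gmom (cnt c' (c 0) + 1) * P := by
    unfold jmom
    rw [← Finset.mul_prod_erase _ _ (Finset.mem_univ (c 0))]
    congr 1
    · rw [h1]; simp [add_comm]
    · refine Finset.prod_congr rfl fun b hb => ?_
      rw [h1, if_neg (Finset.ne_of_mem_erase hb).symm, zero_add]
  have h4 : ∀ s, (if c 0 = c s.succ then jmom (fun q => c (s.succAbove q).succ) else 0)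
      = ((if c' s = c 0 then 1 else 0 : ℕ) : ℝ) * (gmom (cnt c' (c 0) - 1) * P) := by
    intro s
    by_cases h : c 0 = c s.succ
    · have h' : c' s = c 0 := h.symm
      rw [if_pos h, if_pos h', Nat.cast_one, one_mul]
      unfold jmom
      rw [← Finset.mul_prod_erase _ _ (Finset.mem_univ (c 0))]
      congr 1
      · rw [h2 s, if_pos h']; simp [hc']
      · refine Finset.prod_congr rfl fun b hb => ?_
        rw [h2 s, h', if_neg (Finset.ne_of_mem_erase hb).symm, zero_add]
    · have h' : ¬ c' s = c 0 := fun e => h e.symm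
      rw [if_neg h, if_neg h']
      simp
  rw [Finset.sum_congr rfl (fun s _ => h4 s), ← Finset.sum_mul, ← Nat.cast_sum, h3, gmom_succ]
  simp only [cnt]
  ring

/-- Wick's formula, as an existence statement. -/
lemma wick (m : ℕ) : ∃ (K : Type) (_ : Fintype K) (f : K → BrauerPairing (2 * m)),
    Fintype.card K = Nat.doubleFactorial (2 * m - 1) ∧
    ∀ (ι : Type) [DecidableEq ι] [Fintype ι] (c : Fin (2 * m) → ι),
      jmom c = ∑ i, bdelta (f i) c := by
  induction m with
  | zero =>
    refine ⟨Unit, inferInstance, fun _ => ⟨fun p => p.elim0, fun p => p.elim0, fun p => p.elim0⟩,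
      by simp, ?_⟩
    intro ι _ _ c
    have h1 : ∀ a, cnt c a = 0 := fun a => by
      unfold cnt
      exact Finset.sum_eq_zero fun x _ => x.elim0
    simp only [jmom, h1, gmom_zero, Finset.prod_const_one, Finset.univ_unique, Finset.sum_singleton]
    unfold bdelta
    rw [if_pos (fun p => p.elim0)]
  | succ m ih =>
    obtain ⟨K, hK, f, hcard, hf⟩ := ih
    refine ⟨Fin (2 * m + 1) × K, inferInstance, fun x => bext x.1 (f x.2), ?_, ?_⟩
    · rw [Fintype.card_prod, hcard, Fintype.card_fin]
      rcases m with _ | m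
      · simp
      · rw [show 2 * (m + 1 + 1) - 1 = (2 * m + 1) + 2 by omega, Nat.doubleFactorial,
          show 2 * (m + 1) - 1 = 2 * m + 1 by omega]
        ring
    · intro ι _ _ c
      refine (jmom_rec (N := 2 * m) c).trans ?_
      rw [Fintype.sum_prod_type]
      refine Finset.sum_congr rfl fun s _ => ?_
      simp only [bdelta_bext]
      split_ifs with h
      · exact hf _ _
      · simp

lemma tpowM_mul {n : ℕ} (k : ℕ) (g h : Matrix (Fin n) (Fin n) ℝ) :
    tpowM k (g * h) = tpowM k g * tpowM k h := by
  ext I J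
  simp only [tpowM, Matrix.of_apply, Matrix.mul_apply, Finset.prod_univ_sum, Fintype.piFinset_univ,
    Finset.prod_mul_distrib]

lemma tpowM_transpose {n : ℕ} (k : ℕ) (g : Matrix (Fin n) (Fin n) ℝ) :
    tpowM k gᵀ = (tpowM k g)ᵀ := rfl

lemma tpowM_one {n : ℕ} (k : ℕ) : tpowM k (1 : Matrix (Fin n) (Fin n) ℝ) = 1 := by
  ext I J
  simp only [tpowM, Matrix.of_apply, Matrix.one_apply]
  by_cases h : I = J
  · simp [h]
  · rw [if_neg h]
    obtain ⟨r, hr⟩ := Function.ne_iff.1 h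
    exact Finset.prod_eq_zero (Finset.mem_univ r) (if_neg hr)

/-- The quadratic form of `G^{⊗N}` at `T`. -/
def qf {n N : ℕ} (T : (Fin N → Fin n) → ℝ) (G : Matrix (Fin n) (Fin n) ℝ) : ℝ :=
  T ⬝ᵥ (tpowM N G *ᵥ T)

open scoped MatrixOrder in
lemma exists_sqrt_mat {n : ℕ} (A : Matrix (Fin n) (Fin n) ℝ) (hA : A.PosSemidef) :
    ∃ S : Matrix (Fin n) (Fin n) ℝ, S.PosSemidef ∧ S * S = A :=
  ⟨CFC.sqrt A, (CFC.sqrt_nonneg A).posSemidef, CFC.sqrt_mul_sqrt_self A hA.nonneg⟩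

lemma psd_transpose {n : ℕ} {S : Matrix (Fin n) (Fin n) ℝ} (hS : S.PosSemidef) : Sᵀ = S := by
  have := hS.isHermitian.eq
  rwa [Matrix.conjTranspose_eq_transpose_of_trivial] at this

lemma qf_nonneg_of_det {n N : ℕ} (T : (Fin N → Fin n) → ℝ)
    (hT : ∀ g : Matrix (Fin n) (Fin n) ℝ, gᵀ * g = 1 → tpowM N g *ᵥ T = T)
    (G : Matrix (Fin n) (Fin n) ℝ) (hG : G.det ≠ 0) : 0 ≤ qf T G := by
  obtain ⟨S, hS, hSS⟩ := exists_sqrt_mat (Gᵀ * G) (by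
    have := Matrix.posSemidef_conjTranspose_mul_self G
    rwa [Matrix.conjTranspose_eq_transpose_of_trivial] at this)
  obtain ⟨R, hR, hRR⟩ := exists_sqrt_mat S hS
  have hSt := psd_transpose hS
  have hRt := psd_transpose hR
  have hdet : IsUnit S.det := by
    rw [isUnit_iff_ne_zero]
    intro h0
    have := congrArg Matrix.det hSS
    rw [Matrix.det_mul, Matrix.det_mul, Matrix.det_transpose, h0] at this
    simp at this
    exact hG this
  set Q := G * S⁻¹ with hQ
  have hQS : Q * S = G := by rw [hQ, Matrix.mul_assoc, Matrix.nonsing_inv_mul _ hdet, Matrix.mul_one]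
  have hQQ : Qᵀ * Q = 1 := by
    rw [hQ, Matrix.transpose_mul, Matrix.transpose_nonsing_inv, hSt]
    calc S⁻¹ * Gᵀ * (G * S⁻¹) = S⁻¹ * (Gᵀ * G) * S⁻¹ := by simp only [Matrix.mul_assoc]
      _ = (S⁻¹ * S) * (S * S⁻¹) := by rw [← hSS]; simp only [Matrix.mul_assoc]
      _ = 1 := by rw [Matrix.nonsing_inv_mul _ hdet, Matrix.mul_nonsing_inv _ hdet, Matrix.one_mul]
  have hQ' : Qᵀᵀ * Qᵀ = 1 := by
    rw [Matrix.transpose_transpose]; exact mul_eq_one_comm.1 hQQ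
  have e : qf T G = (tpowM N R *ᵥ T) ⬝ᵥ (tpowM N R *ᵥ T) := by
    unfold qf
    rw [← hQS, tpowM_mul, ← Matrix.mulVec_mulVec, Matrix.dotProduct_mulVec,
      ← Matrix.mulVec_transpose, ← tpowM_transpose, hT _ hQ', ← hRR, tpowM_mul,
      ← Matrix.mulVec_mulVec, Matrix.dotProduct_mulVec,
      ← Matrix.mulVec_transpose, ← tpowM_transpose, hRt]
  rw [e]
  exact Finset.sum_nonneg fun i _ => mul_self_nonneg _

lemma qf_expand {n N : ℕ} (T : (Fin N → Fin n) → ℝ) (G : Matrix (Fin n) (Fin n) ℝ) :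
    qf T G = ∑ I, ∑ J, T I * T J * ∏ r, G (I r) (J r) := by
  simp only [qf, dotProduct, Matrix.mulVec, Finset.mul_sum, tpowM, Matrix.of_apply]
  refine Finset.sum_congr rfl fun I _ => Finset.sum_congr rfl fun J _ => ?_
  ring

lemma qf_nonneg {n N : ℕ} (T : (Fin N → Fin n) → ℝ)
    (hT : ∀ g : Matrix (Fin n) (Fin n) ℝ, gᵀ * g = 1 → tpowM N g *ᵥ T = T)
    (G : Matrix (Fin n) (Fin n) ℝ) : 0 ≤ qf T G := by
  have hc : Continuous fun t : ℝ => qf T (Matrix.scalar (Fin n) t - (-G)) := by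
    simp only [qf_expand]
    simp only [Matrix.sub_apply, Matrix.scalar_apply, Matrix.diagonal_apply]
    refine continuous_finsetSum _ fun I _ => continuous_finsetSum _ fun J _ => ?_
    refine continuous_const.mul (continuous_finsetProd _ fun r _ => ?_)
    split_ifs <;> fun_prop
  have hfin : {t : ℝ | (-G).charpoly.IsRoot t}.Finite :=
    Polynomial.finite_setOfPred_isRoot (Matrix.charpoly_monic _).ne_zero
  have hd : Dense {t : ℝ | (-G).charpoly.IsRoot t}ᶜ := hfin.countable.dense_compl ℝ
  have hall : ∀ t : ℝ, 0 ≤ qf T (Matrix.scalar (Fin n) t - (-G)) := by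
    intro t
    have hcl : IsClosed {t : ℝ | 0 ≤ qf T (Matrix.scalar (Fin n) t - (-G))} :=
      isClosed_le continuous_const hc
    have hsub : {t : ℝ | (-G).charpoly.IsRoot t}ᶜ ⊆
        {t : ℝ | 0 ≤ qf T (Matrix.scalar (Fin n) t - (-G))} := by
      intro t ht
      apply qf_nonneg_of_det T hT
      rw [← Matrix.eval_charpoly]
      exact ht
    exact hcl.closure_subset_iff.2 hsub (hd t)
  simpa using hall 0

instance gauss_openPos : (gaussianReal 0 1).IsOpenPosMeasure :=
  (gaussianReal_absolutelyContinuous' 0 one_ne_zero).isOpenPosMeasure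

lemma prod_eq_pow {N : ℕ} {ι : Type} [DecidableEq ι] [Fintype ι] (c : Fin N → ι) (x : ι → ℝ) :
    ∏ r, x (c r) = ∏ a, x a ^ cnt c a := by
  simp only [cnt, ← Finset.prod_pow_eq_pow_sum]
  rw [Finset.prod_comm]
  refine Finset.prod_congr rfl fun r _ => ?_
  simp [Finset.prod_ite_eq]

lemma jint {N : ℕ} {ι : Type} [DecidableEq ι] [Fintype ι] (c : Fin N → ι) :
    Integrable (fun x : ι → ℝ => ∏ r, x (c r)) (Measure.pi fun _ => gaussianReal 0 1) := by
  simp only [prod_eq_pow]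
  exact Integrable.fintype_prod (f := fun a x => x ^ cnt c a) fun a => gint _

lemma jmom_eq {N : ℕ} {ι : Type} [DecidableEq ι] [Fintype ι] (c : Fin N → ι) :
    ∫ x : ι → ℝ, ∏ r, x (c r) ∂(Measure.pi fun _ => gaussianReal 0 1) = jmom c := by
  simp only [prod_eq_pow]
  exact integral_fintype_prod_eq_prod (fun a x => x ^ cnt c a)

lemma bdelta_prod {N n : ℕ} (β : BrauerPairing N) (I J : Fin N → Fin n) :
    bdelta β (fun r => (I r, J r)) = bdelta β I * bdelta β J := by
  simp only [bdelta, Prod.mk.injEq, forall_and]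
  rw [ite_zero_mul_ite_zero, mul_one]

lemma inv_orth_zero {n m : ℕ} {K : Type} [Fintype K] (f : K → BrauerPairing (2 * m))
    (hf : ∀ (ι : Type) [DecidableEq ι] [Fintype ι] (c : Fin (2 * m) → ι),
      jmom c = ∑ i, bdelta (f i) c)
    (T : (Fin (2 * m) → Fin n) → ℝ)
    (hT : ∀ g : Matrix (Fin n) (Fin n) ℝ, gᵀ * g = 1 → tpowM (2 * m) g *ᵥ T = T)
    (ho : ∀ i, ∑ I, T I * bdelta (f i) I = 0) : T = 0 := by
  let μ : Measure (Fin n × Fin n → ℝ) := Measure.pi fun _ => gaussianReal 0 1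
  let p : (Fin n × Fin n → ℝ) → ℝ := fun x => qf T (Matrix.of fun i j => x (i, j))
  have hp : p = fun x => ∑ I, ∑ J, T I * T J * ∏ r, x (I r, J r) := by
    funext x
    exact qf_expand _ _
  have hInt : ∀ I J : Fin (2 * m) → Fin n, Integrable
      (fun x : Fin n × Fin n → ℝ => T I * T J * ∏ r, x (I r, J r)) μ :=
    fun I J => (jint (fun r => (I r, J r))).const_mul _
  have hpi : Integrable p μ := by
    rw [hp]
    exact integrable_finsetSum _ fun I _ => integrable_finsetSum _ fun J _ => hInt I J
  have hp0 : ∫ x, p x ∂μ = 0 := by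
    rw [hp]
    rw [integral_finsetSum _ fun I _ => integrable_finsetSum _ fun J _ => hInt I J]
    have : ∀ I : Fin (2 * m) → Fin n, ∫ x, ∑ J, T I * T J * ∏ r, x (I r, J r) ∂μ =
        ∑ i, ∑ J, (T I * bdelta (f i) I) * (T J * bdelta (f i) J) := by
      intro I
      rw [integral_finsetSum _ fun J _ => hInt I J, Finset.sum_comm]
      refine Finset.sum_congr rfl fun J _ => ?_
      rw [integral_const_mul, jmom_eq (fun r => (I r, J r)), hf, Finset.mul_sum]
      refine Finset.sum_congr rfl fun i _ => ?_
      rw [bdelta_prod]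
      ring
    simp only [this, ← Finset.mul_sum, ho, mul_zero, Finset.sum_const_zero]
  have hnn : 0 ≤ p := fun x => qf_nonneg T hT _
  have hae : p =ᵐ[μ] 0 := (integral_eq_zero_iff_of_nonneg hnn hpi).1 hp0
  have hcont : Continuous p := by
    rw [hp]
    fun_prop
  have hz : p = 0 := Continuous.ae_eq_iff_eq μ hcont continuous_zero |>.1 hae
  have h1 := congrFun hz (fun ij => (1 : Matrix (Fin n) (Fin n) ℝ) ij.1 ij.2)
  have h2 : T ⬝ᵥ T = 0 := by
    have : qf T 1 = 0 := h1
    rwa [qf, tpowM_one, Matrix.one_mulVec] at this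
  exact dotProduct_self_eq_zero.1 h2

lemma inv_mem_span {n m : ℕ} {K : Type} [Fintype K] (f : K → BrauerPairing (2 * m))
    (hf : ∀ (ι : Type) [DecidableEq ι] [Fintype ι] (c : Fin (2 * m) → ι),
      jmom c = ∑ i, bdelta (f i) c)
    (hb : ∀ i, ∀ g : Matrix (Fin n) (Fin n) ℝ, gᵀ * g = 1 →
      tpowM (2 * m) g *ᵥ (bdelta (f i)) = bdelta (f i))
    (T : (Fin (2 * m) → Fin n) → ℝ)
    (hT : ∀ g : Matrix (Fin n) (Fin n) ℝ, gᵀ * g = 1 → tpowM (2 * m) g *ᵥ T = T) :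
    T ∈ Submodule.span ℝ (Set.range fun i => (bdelta (f i) : (Fin (2 * m) → Fin n) → ℝ)) := by
  set W := Submodule.span ℝ (Set.range fun i => (bdelta (f i) : (Fin (2 * m) → Fin n) → ℝ))
    with hW
  let e := (WithLp.linearEquiv 2 ℝ ((Fin (2 * m) → Fin n) → ℝ))
  let W' : Submodule ℝ (EuclideanSpace ℝ (Fin (2 * m) → Fin n)) := W.comap e.toLinearMap
  obtain ⟨y, hy, z, hz, hyz⟩ := W'.exists_add_mem_mem_orthogonal (WithLp.toLp 2 T)
  have hyW : e y ∈ W := hy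
  have hTe : T = e y + e z := by
    rw [← map_add, ← hyz]; rfl
  have hinvW : ∀ w ∈ W, ∀ g : Matrix (Fin n) (Fin n) ℝ, gᵀ * g = 1 →
      tpowM (2 * m) g *ᵥ w = w := by
    intro w hw g hg
    refine Submodule.span_induction (p := fun w _ => tpowM (2 * m) g *ᵥ w = w) ?_ ?_ ?_ ?_ hw
    · rintro _ ⟨i, rfl⟩
      exact hb i g hg
    · simp
    · intro x y _ _ hx hy
      rw [Matrix.mulVec_add, hx, hy]
    · intro a x _ hx
      rw [Matrix.mulVec_smul, hx]
  have hz0 : e z = 0 := by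
    refine inv_orth_zero f hf (e z) ?_ ?_
    · intro g hg
      have : e z = T - e y := by rw [hTe]; simp
      rw [this, Matrix.mulVec_sub, hT g hg, hinvW _ hyW g hg]
    · intro i
      have hm : WithLp.toLp 2 (bdelta (f i) : (Fin (2 * m) → Fin n) → ℝ) ∈ W' :=
        Submodule.subset_span ⟨i, rfl⟩
      have := (Submodule.mem_orthogonal _ _).1 hz _ hm
      rw [EuclideanSpace.inner_eq_star_dotProduct] at this
      simp [dotProduct] at this
      exact this
  rw [hTe, hz0, add_zero]
  exact hyW

lemma bp_lt {N : ℕ} (β : BrauerPairing N) {p : Fin N} (h : ¬ p < β.pair p) :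
    β.pair p < β.pair (β.pair p) := by
  rw [β.invol]
  exact lt_of_le_of_ne (not_lt.1 h) (β.ne p)

lemma bdelta_eq_prod {N n : ℕ} (β : BrauerPairing N) (c : Fin N → Fin n) :
    bdelta β c = ∏ p ∈ Finset.univ.filter (fun p => p < β.pair p),
      if c p = c (β.pair p) then (1 : ℝ) else 0 := by
  rw [Finset.prod_ite_zero, Finset.prod_const_one]
  unfold bdelta
  congr 1
  rw [eq_iff_iff]
  constructor
  · intro h p _
    exact h p
  · intro h p
    by_cases hp : p < β.pair p
    · exact h p (by simpa using hp)
    · have := h (β.pair p) (Finset.mem_filter.2 ⟨Finset.mem_univ _, bp_lt β hp⟩)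
      rw [β.invol] at this
      exact this.symm

lemma prod_pairs {N : ℕ} (β : BrauerPairing N) (F : Fin N → ℝ) :
    ∏ r, F r = ∏ p : {p // p < β.pair p}, F p * F (β.pair p) := by
  rw [← Finset.prod_filter_mul_prod_filter_not Finset.univ (fun p => p < β.pair p)]
  rw [← Finset.prod_subtype (Finset.univ.filter (fun p => p < β.pair p)) (by simp)
    (fun p => F p * F (β.pair p)), Finset.prod_mul_distrib]
  congr 1
  refine Finset.prod_nbij' β.pair β.pair ?_ ?_ ?_ ?_ ?_
  · intro p hp
    simp only [Finset.mem_filter, Finset.mem_univ, true_and] at hp ⊢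
    exact bp_lt β hp
  · intro p hp
    simp only [Finset.mem_filter, Finset.mem_univ, true_and] at hp ⊢
    rw [β.invol]
    exact not_lt.2 hp.le
  · intro p _
    exact β.invol p
  · intro p _
    exact β.invol p
  · intro p _
    rw [β.invol]

lemma bdelta_inv {N n : ℕ} (β : BrauerPairing N) (g : Matrix (Fin n) (Fin n) ℝ)
    (hg : gᵀ * g = 1) : tpowM N g *ᵥ (bdelta β) = bdelta β := by
  have hg' : g * gᵀ = 1 := mul_eq_one_comm.1 hg
  have hgg : ∀ a b, ∑ j, g a j * g b j = if a = b then 1 else 0 := by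
    intro a b
    have := congrFun (congrFun hg' a) b
    rwa [Matrix.mul_apply, Matrix.one_apply] at this
  funext I
  rw [bdelta_eq_prod β I]
  rw [Finset.prod_subtype (Finset.univ.filter (fun p => p < β.pair p))
    (p := fun p => p < β.pair p) (by simp)]
  simp only [← hgg]
  rw [Finset.prod_univ_sum, Fintype.piFinset_univ]
  simp only [Matrix.mulVec, dotProduct, bdelta, tpowM, Matrix.of_apply, mul_ite, mul_one, mul_zero]
  rw [← Finset.sum_filter]
  refine Finset.sum_bij' (fun J _ p => J p.1)
    (fun x _ p => if h : p < β.pair p then x ⟨p, h⟩ else x ⟨β.pair p, bp_lt β h⟩) ?_ ?_ ?_ ?_ ?_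
  · intros
    exact Finset.mem_univ _
  · intro x _
    simp only [Finset.mem_filter, Finset.mem_univ, true_and]
    intro p
    by_cases hp : p < β.pair p
    · have h2 : ¬ β.pair p < β.pair (β.pair p) := by
        rw [β.invol]
        exact not_lt.2 hp.le
      rw [dif_pos hp, dif_neg h2]
      simp only [β.invol]
    · rw [dif_neg hp, dif_pos (bp_lt β hp)]
  · intro J hJ
    simp only [Finset.mem_filter, Finset.mem_univ, true_and] at hJ
    funext p
    by_cases hp : p < β.pair p
    · simp [hp]
    · simp only [hp, dite_false]
      exact (hJ p).symm
  · intro x _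
    funext p
    simp [p.2]
  · intro J hJ
    simp only [Finset.mem_filter, Finset.mem_univ, true_and] at hJ
    rw [prod_pairs β]
    refine Finset.prod_congr rfl fun p _ => ?_
    rw [← hJ p.1]

/-- A linear map as a tensor. -/
def flat (n k l : ℕ) : (((Fin k → Fin n) → ℝ) →ₗ[ℝ] ((Fin l → Fin n) → ℝ)) ≃ₗ[ℝ]
    ((Fin (l + k) → Fin n) → ℝ) :=
  LinearMap.toMatrix' ≪≫ₗ
    { toFun := fun A c => A (fun i => c (Fin.castAdd k i)) (fun j => c (Fin.natAdd l j))
      invFun := fun T I J => T (Fin.append I J)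
      map_add' := fun _ _ => rfl
      map_smul' := fun _ _ => rfl
      left_inv := fun A => by
        ext I J
        simp
      right_inv := fun T => by
        funext c
        simp only [Fin.append_castAdd_natAdd] }

lemma flat_brauer (n k l : ℕ) (β : BrauerPairing (l + k)) :
    flat n k l (brauerMatrix n k l β).mulVecLin = bdelta β := by
  funext c
  rw [bdelta_eq_prod]
  have h : LinearMap.toMatrix' (brauerMatrix n k l β).mulVecLin = brauerMatrix n k l β :=
    LinearMap.toMatrix'_toLin' _
  change LinearMap.toMatrix' (brauerMatrix n k l β).mulVecLin _ _ = _
  rw [h]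
  simp only [brauerMatrix, Matrix.of_apply, Fin.append_castAdd_natAdd]

lemma flat_equiv (n k l : ℕ) (φ : ((Fin k → Fin n) → ℝ) →ₗ[ℝ] ((Fin l → Fin n) → ℝ))
    (g : Matrix (Fin n) (Fin n) ℝ) (hg : gᵀ * g = 1) :
    φ ∘ₗ (tpowM k g).mulVecLin = (tpowM l g).mulVecLin ∘ₗ φ ↔
      tpowM (l + k) g *ᵥ flat n k l φ = flat n k l φ := by
  set A := LinearMap.toMatrix' φ with hA
  have hflat : ∀ I J, flat n k l φ (Fin.append I J) = A I J := by
    intro I J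
    change A _ _ = _
    simp
  have hgg := congrArg (tpowM k) hg
  rw [tpowM_mul, tpowM_transpose, tpowM_one] at hgg
  have hgg' := mul_eq_one_comm.1 hgg
  have h1 : φ ∘ₗ (tpowM k g).mulVecLin = (tpowM l g).mulVecLin ∘ₗ φ ↔
      A * tpowM k g = tpowM l g * A := by
    rw [← LinearMap.toMatrix'.injective.eq_iff, LinearMap.toMatrix'_comp, LinearMap.toMatrix'_comp]
    have h : ∀ q, LinearMap.toMatrix' (tpowM q g).mulVecLin = tpowM q g :=
      fun q => LinearMap.toMatrix'_toLin' _
    rw [h, h]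
  have h2 : ∀ I J, (tpowM (l + k) g *ᵥ flat n k l φ) (Fin.append I J) =
      (tpowM l g * A * (tpowM k g)ᵀ) I J := by
    intro I J
    simp only [Matrix.mulVec, dotProduct, Matrix.mul_apply, Matrix.transpose_apply, Finset.sum_mul]
    rw [← (Fin.appendEquiv l k).sum_comp, Fintype.sum_prod_type, Finset.sum_comm]
    refine Finset.sum_congr rfl fun J' _ => Finset.sum_congr rfl fun I' _ => ?_
    simp only [Fin.appendEquiv, Equiv.coe_fn_mk, hflat, tpowM, Matrix.of_apply, Fin.prod_univ_add,
      Fin.append_left, Fin.append_right]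
    ring
  have h3 : tpowM (l + k) g *ᵥ flat n k l φ = flat n k l φ ↔
      tpowM l g * A * (tpowM k g)ᵀ = A := by
    constructor
    · intro h
      ext I J
      rw [← h2, h, hflat]
    · intro h
      funext c
      have := h2 (fun i => c (Fin.castAdd k i)) (fun j => c (Fin.natAdd l j))
      rw [h, ← hflat, Fin.append_castAdd_natAdd] at this
      exact this
  rw [h1, h3]
  constructor
  · intro h
    rw [← h, Matrix.mul_assoc, hgg', Matrix.mul_one]
  · intro h
    conv_lhs => rw [← h]
    rw [Matrix.mul_assoc, hgg, Matrix.mul_one]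

lemma fft_flat {n N : ℕ} (hN : Even N) :
    ∃ (K : Type) (_ : Fintype K) (f : K → BrauerPairing N),
    Fintype.card K = Nat.doubleFactorial (N - 1) ∧
    ∀ T : (Fin N → Fin n) → ℝ,
    (∀ g : Matrix (Fin n) (Fin n) ℝ, gᵀ * g = 1 → tpowM N g *ᵥ T = T) →
    T ∈ Submodule.span ℝ (Set.range fun i => (bdelta (f i) : (Fin N → Fin n) → ℝ)) := by
  obtain ⟨m, rfl⟩ := hN.exists_two_nsmul
  rw [smul_eq_mul]
  obtain ⟨K, hK, f, hc, hf⟩ := wick m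
  exact ⟨K, hK, f, hc, fun T hT => inv_mem_span f hf (fun i g hg => bdelta_inv _ g hg) T hT⟩

/-- For `l + k` even, the maps `E_β` (over all `(k,l)`-Brauer partitions `β`) span
`Hom_{O(n)}((ℝⁿ)^{⊗k}, (ℝⁿ)^{⊗l})`; in particular, the dimension of this space is
at most `(l + k - 1)!!`. -/
theorem stmt2 (n k l : ℕ) (hn : 1 ≤ n) (heven : Even (l + k)) :
    Submodule.span ℝ
      {φ : ((Fin k → Fin n) → ℝ) →ₗ[ℝ] ((Fin l → Fin n) → ℝ) |
        ∃ β : BrauerPairing (l + k), φ = (brauerMatrix n k l β).mulVecLin}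
      = EquivSub k l (fun g => gᵀ * g = 1) ∧
    Module.finrank ℝ (EquivSub (n := n) k l (fun g => gᵀ * g = 1)) ≤
      Nat.doubleFactorial (l + k - 1) := by
  obtain ⟨K, hK, f, hc, hspan⟩ := fft_flat (n := n) heven
  have hle : EquivSub k l (fun g => gᵀ * g = 1) ≤ Submodule.span ℝ
      (Set.range fun i => (brauerMatrix n k l (f i)).mulVecLin) := by
    intro φ hφ
    have h := hspan (flat n k l φ) (fun g hg => (flat_equiv n k l φ g hg).1 (hφ g hg))
    have hr : (Set.range fun i => (bdelta (f i) : (Fin (l + k) → Fin n) → ℝ)) =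
        (flat n k l).toLinearMap '' (Set.range fun i => (brauerMatrix n k l (f i)).mulVecLin) := by
      rw [← Set.range_comp]
      congr 1
      funext i
      exact (flat_brauer n k l (f i)).symm
    rw [hr, Submodule.span_image] at h
    obtain ⟨ψ, hψ, he⟩ := h
    rwa [← (flat n k l).injective he]
  refine ⟨le_antisymm ?_ ?_, ?_⟩
  · rw [Submodule.span_le]
    rintro _ ⟨β, rfl⟩ g hg
    rw [flat_equiv n k l _ g hg, flat_brauer]
    exact bdelta_inv β g hg
  · refine hle.trans (Submodule.span_mono ?_)
    rintro _ ⟨i, rfl⟩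
    exact ⟨f i, rfl⟩
  · refine (Submodule.finrank_mono hle).trans ?_
    rw [← hc]
    exact finrank_range_le_card _
end
end

section
/- Let n = 2m ≥ 2 and k, l ≥ 0 be integers with l + k even. Then the set {F_β : β a (k,l)-Brauer partition} spans the vector space Hom_{Sp(n)}((ℝⁿ)^{⊗k},(ℝⁿ)^{⊗l}) of Sp(n)-equivariant linear maps; in particular this space has dimension at most (l+k−1)!! = (l+k−1)(l+k−3)⋯3·1. -/
open Matrix

noncomputable section

/-- Equivariance for the set of matrices satisfying `P`. -/
def IsGEquiv {n : ℕ} (k l : ℕ) (P : Matrix (Fin n) (Fin n) ℝ → Prop)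
    (φ : ((Fin k → Fin n) → ℝ) →ₗ[ℝ] ((Fin l → Fin n) → ℝ)) : Prop :=
  ∀ g : Matrix (Fin n) (Fin n) ℝ, P g →
    φ ∘ₗ (tpowM k g).mulVecLin = (tpowM l g).mulVecLin ∘ₗ φ

/-- The matrix `Ω` of the standard skew-symmetric form in the symplectic basis:
block diagonal with `m` blocks `[[0, 1], [-1, 0]]`.  Its entries are the `ε_{i,j}`. -/
def OmegaM (n : ℕ) : Matrix (Fin n) (Fin n) ℝ :=
  Matrix.of fun i j =>
    if (i : ℕ) % 2 = 0 ∧ (j : ℕ) = (i : ℕ) + 1 then 1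
    else if (j : ℕ) % 2 = 0 ∧ (i : ℕ) = (j : ℕ) + 1 then -1 else 0

/-- The matrix `F_β` of a `(k,l)`-Brauer partition `β` for the symplectic group:
the `(I,J)` entry is `∏_{{p,q} ∈ β, p < q} γ_{c_p, c_q}` where `c = I ⌢ J`, and
`γ_{c_p,c_q}` is `δ_{c_p,c_q}` if `p, q` lie in different rows (exactly one of
them is `< l`), and `ε_{c_p,c_q}` if they lie in the same row. -/
def sympBrauerMatrix (n k l : ℕ) (β : BrauerPairing (l + k)) :
    Matrix (Fin l → Fin n) (Fin k → Fin n) ℝ :=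
  Matrix.of fun I J =>
    ∏ p ∈ Finset.univ.filter (fun p => p < β.pair p),
      if ((p : ℕ) < l ↔ ((β.pair p : Fin (l + k)) : ℕ) < l) then
        OmegaM n (Fin.append I J p) (Fin.append I J (β.pair p))
      else if Fin.append I J p = Fin.append I J (β.pair p) then (1 : ℝ) else 0

section FFT
set_option linter.unusedSectionVars false
variable {ι X : Type} [DecidableEq ι] [Fintype X] [DecidableEq X]

/-- skew form attached to an involution and a sign -/
def Om (pt : X → X) (s : X → ℝ) (x y : X) : ℝ := if y = pt x then s x else 0

/-- tensors depending on the coordinates in `S` only and killed by the symplectic Lie algebra -/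
def WInv (pt : X → X) (s : X → ℝ) (S : Finset ι) : Submodule ℝ ((ι → X) → ℝ) where
  carrier := {f | (∀ p, p ∉ S → ∀ c x, f (Function.update c p x) = f c) ∧
    ∀ u v c, ∑ p ∈ S, (Om pt s u (c p) * f (Function.update c p v)
      + Om pt s v (c p) * f (Function.update c p u)) = 0}
  add_mem' := by
    rintro f g ⟨hf, hf'⟩ ⟨hg, hg'⟩
    refine ⟨fun p hp c x => by simp [hf p hp, hg p hp], fun u v c => ?_⟩
    have := congrArg₂ (· + ·) (hf' u v c) (hg' u v c)
    simp only [← Finset.sum_add_distrib, add_zero] at this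
    rw [← this]
    refine Finset.sum_congr rfl fun p _ => ?_
    simp only [Pi.add_apply]; ring
  zero_mem' := by constructor <;> simp
  smul_mem' := by
    rintro a f ⟨hf, hf'⟩
    refine ⟨fun p hp c x => by simp [hf p hp], fun u v c => ?_⟩
    have := congrArg (a * ·) (hf' u v c)
    simp only [Finset.mul_sum, mul_zero] at this
    rw [← this]
    refine Finset.sum_congr rfl fun p _ => ?_
    simp only [Pi.smul_apply, smul_eq_mul]; ring

/-- products of the form over a perfect matching of `S` -/
inductive Gen (pt : X → X) (s : X → ℝ) : Finset ι → ((ι → X) → ℝ) → Prop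
  | nil : Gen pt s ∅ (fun _ => 1)
  | cons (S : Finset ι) (h : (ι → X) → ℝ) (p q : ι) (hp : p ∉ S) (hq : q ∉ S) (hpq : p ≠ q)
      (hh : Gen pt s S h) :
      Gen pt s (insert p (insert q S)) (fun c => Om pt s (c p) (c q) * h c)

def BS (pt : X → X) (s : X → ℝ) (S : Finset ι) : Submodule ℝ ((ι → X) → ℝ) :=
  Submodule.span ℝ {h | Gen pt s S h}

/-- contraction -/
def Ctr (pt : X → X) (s : X → ℝ) (p q : ι) (f : (ι → X) → ℝ) : (ι → X) → ℝ :=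
  fun c => ∑ a, s (pt a) * f (Function.update (Function.update c p a) q (pt a))

lemma BS_cons (pt : X → X) (s : X → ℝ) (S : Finset ι) (p q : ι) (hp : p ∈ S) (hq : q ∈ S)
    (hpq : p ≠ q) (h : (ι → X) → ℝ) (hh : h ∈ BS pt s ((S.erase p).erase q)) :
    (fun c => Om pt s (c p) (c q) * h c) ∈ BS pt s S := by
  have key : ((S.erase p).erase q) = ((S.erase p).erase q) := rfl
  induction hh using Submodule.span_induction with
  | mem x hx =>
    apply Submodule.subset_span
    have := Gen.cons ((S.erase p).erase q) x p q (by simp) (by simp) hpq hx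
    have e : insert p (insert q ((S.erase p).erase q)) = S := by
      rw [Finset.insert_erase (by simp [hq, hpq.symm]), Finset.insert_erase hp]
    rw [e] at this
    exact this
  | zero => 
    convert Submodule.zero_mem _ using 1
    ext c; simp
  | add x y _ _ hx hy =>
    convert Submodule.add_mem _ hx hy using 1
    ext c; simp [mul_add]
  | smul a x _ hx =>
    convert Submodule.smul_mem _ a hx using 1
    ext c; simp only [Pi.smul_apply, smul_eq_mul]; ring

variable {pt : X → X} {s : X → ℝ}

lemma Ctr_mem (hpt : ∀ x, pt (pt x) = x) (hs : ∀ x, s (pt x) = - s x) (hs2 : ∀ x, s x * s x = 1)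
    (S : Finset ι) (p q : ι) (hp : p ∈ S) (hq : q ∈ S) (hpq : p ≠ q) (f : (ι → X) → ℝ)
    (hf : f ∈ WInv pt s S) : Ctr pt s p q f ∈ WInv pt s ((S.erase p).erase q) := by
  obtain ⟨hd, hl⟩ := hf
  refine ⟨fun r hr c x => ?_, fun u v c => ?_⟩
  · unfold Ctr
    refine Finset.sum_congr rfl fun a _ => ?_
    by_cases h1 : r = p
    · subst h1; simp
    by_cases h2 : r = q
    · subst h2
      rw [Function.update_comm hpq]
      simp [Function.update_comm hpq]
    · have : r ∉ S := by simpa [h1, h2] using hr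
      rw [Function.update_comm h1, Function.update_comm h2, hd r this]
  · have key : ∀ a, s (pt a) * ∑ r ∈ (S.erase p).erase q,
        (Om pt s u (c r) * f (Function.update (Function.update (Function.update c r v) p a) q (pt a))
        + Om pt s v (c r) * f (Function.update (Function.update (Function.update c r u) p a) q (pt a)))
        = - (s (pt a) * (Om pt s u a * f (Function.update (Function.update c p v) q (pt a))
          + Om pt s v a * f (Function.update (Function.update c p u) q (pt a))))
          - (s (pt a) * (Om pt s u (pt a) * f (Function.update (Function.update c p a) q v)
          + Om pt s v (pt a) * f (Function.update (Function.update c p a) q u))) := by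
      intro a
      have h := hl u v (Function.update (Function.update c p a) q (pt a))
      rw [← Finset.add_sum_erase _ _ hp, 
        ← Finset.add_sum_erase (S.erase p) _ (by simp [hq, hpq.symm] : q ∈ S.erase p)] at h
      simp only [Function.update_self, Function.update_idem, Function.update_of_ne hpq] at h
      have e : ∀ z, Function.update (Function.update (Function.update c p a) q (pt a)) p z
          = Function.update (Function.update c p z) q (pt a) := by
        intro z
        rw [Function.update_comm hpq.symm, Function.update_idem]
      rw [e, e] at h
      rw [Finset.sum_congr rfl (g := fun r => 
        Om pt s u (Function.update (Function.update c p a) q (pt a) r) *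
          f (Function.update (Function.update (Function.update c p a) q (pt a)) r v) +
        Om pt s v (Function.update (Function.update c p a) q (pt a) r) *
          f (Function.update (Function.update (Function.update c p a) q (pt a)) r u))]
      · linear_combination s (pt a) * h
      · intro r hr
        simp only [Finset.mem_erase] at hr
        rw [Function.update_of_ne hr.1, Function.update_of_ne hr.2.1,
          Function.update_comm hr.2.1, Function.update_comm hr.1,
          Function.update_comm hr.2.1, Function.update_comm hr.1]
    have h2 : ∑ r ∈ (S.erase p).erase q, (Om pt s u (c r) * Ctr pt s p q f (Function.update c r v)
        + Om pt s v (c r) * Ctr pt s p q f (Function.update c r u)) = 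
        ∑ a, s (pt a) * ∑ r ∈ (S.erase p).erase q,
        (Om pt s u (c r) * f (Function.update (Function.update (Function.update c r v) p a) q (pt a))
        + Om pt s v (c r) * f (Function.update (Function.update (Function.update c r u) p a) q (pt a))) := by
      unfold Ctr
      simp only [Finset.mul_sum]
      rw [Finset.sum_comm]
      refine Finset.sum_congr rfl fun a _ => ?_
      rw [← Finset.sum_add_distrib]
      exact Finset.sum_congr rfl fun r _ => by ring
    rw [h2, Finset.sum_congr rfl (fun a _ => key a)]
    have inj : ∀ a b, pt a = pt b ↔ a = b := fun a b => 
      ⟨fun h => by rw [← hpt a, h, hpt], fun h => by rw [h]⟩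
    simp only [Om, inj, mul_add, ite_mul, zero_mul, mul_ite, mul_zero, Finset.sum_sub_distrib,
      Finset.sum_neg_distrib, Finset.sum_add_distrib, Finset.sum_ite_eq', Finset.mem_univ, if_true,
      hpt, hs]
    have := hs2 u
    have := hs2 v
    grind

lemma main_rel (hpt : ∀ x, pt (pt x) = x) (hs : ∀ x, s (pt x) = - s x) (hs2 : ∀ x, s x * s x = 1)
    (S : Finset ι) (p : ι) (hp : p ∈ S) (f : (ι → X) → ℝ)
    (hf : f ∈ WInv pt s S) (c : ι → X) : 
    (Fintype.card X + 1 : ℝ) * f c + ∑ q ∈ S.erase p, f (c ∘ Equiv.swap p q)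
     + ∑ q ∈ S.erase p, Om pt s (c p) (c q) * Ctr pt s p q f c = 0 := by
  obtain ⟨hd, hl⟩ := hf
  have key : ∀ a, (f c + s (pt a) * Om pt s (c p) a * f (Function.update c p (pt a)))
      + ∑ q ∈ S.erase p, (s (pt a) * Om pt s (pt a) (c q) * 
          f (Function.update (Function.update c p a) q (c p))
        + Om pt s (c p) (c q) * (s (pt a) * f (Function.update (Function.update c p a) q (pt a)))) = 0 := by
    intro a
    have h := hl (pt a) (c p) (Function.update c p a)
    rw [← Finset.add_sum_erase _ _ hp] at h
    simp only [Function.update_self, Function.update_idem, Function.update_eq_self] at h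
    have e : Om pt s (pt a) a = s (pt a) := by simp [Om, hpt]
    rw [e] at h
    rw [Finset.sum_congr rfl (g := fun q => s (pt a) * 
      (Om pt s (pt a) (Function.update c p a q) * f (Function.update (Function.update c p a) q (c p)) +
          Om pt s (c p) (Function.update c p a q) * f (Function.update (Function.update c p a) q (pt a))))]
    · rw [← Finset.mul_sum]
      linear_combination s (pt a) * h - f c * hs2 (pt a)
    · intro q hq
      simp only [Finset.mem_erase] at hq
      rw [Function.update_of_ne hq.1]; ring
  have h := Finset.sum_congr (rfl : (Finset.univ : Finset X) = Finset.univ) (fun a _ => key a)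
  rw [Finset.sum_const_zero, Finset.sum_add_distrib, Finset.sum_comm, Finset.sum_add_distrib] at h
  rw [← h, add_assoc, ← Finset.sum_add_distrib]
  congr 1
  · simp only [Om, mul_ite, mul_zero, ite_mul, zero_mul, Finset.sum_ite_eq', Finset.mem_univ, if_true,
      hpt, hs2, Function.update_eq_self, Finset.sum_const, Finset.card_univ, nsmul_eq_mul]
    ring
  · refine Finset.sum_congr rfl fun q hq => ?_
    rw [Finset.sum_add_distrib, ← Finset.mul_sum]
    congr 1
    simp only [Om, hpt, mul_ite, mul_zero, ite_mul, zero_mul, Finset.sum_ite_eq, Finset.mem_univ, if_true,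
      hs2, one_mul]
    congr 1
    ext r
    simp only [Finset.mem_erase] at hq
    simp only [Function.comp, Equiv.swap_apply_def, Function.update_apply]
    split_ifs <;> simp_all

lemma swap_mem (S : Finset ι) (i j : ι) (hi : i ∈ S) (hj : j ∈ S) (f : (ι → X) → ℝ)
    (hf : f ∈ WInv pt s S) : (fun c => f (c ∘ Equiv.swap i j)) ∈ WInv pt s S := by
  obtain ⟨hd, hl⟩ := hf
  have e : ∀ (c : ι → X) p x, Function.update c p x ∘ Equiv.swap i j = 
      Function.update (c ∘ Equiv.swap i j) (Equiv.swap i j p) x := by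
    intro c p x
    rw [Function.update_comp_equiv]; simp
  have hS : ∀ p, Equiv.swap i j p ∈ S ↔ p ∈ S := by
    intro p
    rw [Equiv.swap_apply_def]
    split_ifs <;> simp_all
  refine ⟨fun p hp c x => ?_, fun u v c => ?_⟩
  · simp only
    rw [e, hd _ (by rwa [hS])]
  · rw [← hl u v (c ∘ Equiv.swap i j)]
    refine Finset.sum_bij' (fun p _ => Equiv.swap i j p) (fun p _ => Equiv.swap i j p) 
      (by simp [hS]) (by simp [hS]) (by simp) (by simp) ?_
    intro p hp
    simp only [e]
    simp

lemma anti_mem (hpt : ∀ x, pt (pt x) = x) (hs : ∀ x, s (pt x) = - s x) (hs2 : ∀ x, s x * s x = 1)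
    (S : Finset ι) 
    (IH : ∀ p ∈ S, ∀ q ∈ S, p ≠ q → WInv pt s ((S.erase p).erase q) ≤ BS pt s ((S.erase p).erase q))
    (d : ℕ) : ∀ (Q : Finset ι), Q ⊆ S → Q.Nonempty → Q.card + d = S.card → ∀ f ∈ WInv pt s S,
      (∀ i ∈ Q, ∀ j ∈ Q, i ≠ j → ∀ c, f (c ∘ Equiv.swap i j) = - f c) → f ∈ BS pt s S := by
  induction d with
  | zero => ?_
  | succ d ihd => ?_
  all_goals
    intro Q hQS hQ hcard f hf hanti
    by_cases hbig : Fintype.card X < Q.card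
    · have : f = 0 := by
        ext c
        obtain ⟨i, hi, j, hj, hij, hc⟩ := Finset.exists_ne_map_eq_of_card_lt_of_maps_to 
          (s := Q) (t := Finset.univ) (f := c) (by simpa using hbig) (by simp)
        have h1 : c ∘ Equiv.swap i j = c := by
          ext r
          simp only [Function.comp, Equiv.swap_apply_def]
          split_ifs <;> simp_all
        have := hanti i hi j hj hij c
        rw [h1] at this
        simp only [Pi.zero_apply]; linarith
      rw [this]; exact Submodule.zero_mem _
    have hR : ∀ j ∈ Q, (fun c => ((Fintype.card X : ℝ) + 2 - Q.card) * f c 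
        + ∑ i ∈ S \ Q, f (c ∘ Equiv.swap j i)) ∈ BS pt s S := by
      intro j hj
      have : (fun c => ((Fintype.card X : ℝ) + 2 - Q.card) * f c 
        + ∑ i ∈ S \ Q, f (c ∘ Equiv.swap j i)) = 
          - ∑ q ∈ S.erase j, fun c => Om pt s (c j) (c q) * Ctr pt s j q f c := by
        ext c
        have h := main_rel hpt hs hs2 S j (hQS hj) f hf c
        have e1 : S.erase j = (S \ Q) ∪ Q.erase j := by
          ext r; simp only [Finset.mem_erase, Finset.mem_union, Finset.mem_sdiff]
          constructor
          · rintro ⟨h1, h2⟩; tauto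
          · rintro (⟨h1, h2⟩ | ⟨h1, h2⟩)
            · exact ⟨fun h => h2 (h ▸ hj), h1⟩
            · exact ⟨h1, hQS h2⟩
        have hdis : Disjoint (S \ Q) (Q.erase j) := by
          rw [Finset.disjoint_left]; intro r; simp; tauto
        have e2 : ∑ q ∈ S.erase j, f (c ∘ Equiv.swap j q) = 
            ∑ q ∈ S \ Q, f (c ∘ Equiv.swap j q) - ((Q.card : ℝ) - 1) * f c := by
          rw [e1, Finset.sum_union hdis, Finset.sum_congr rfl (s₁ := Q.erase j) (g := fun q => - f c)]
          · rw [Finset.sum_const, Finset.card_erase_of_mem hj, nsmul_eq_mul, 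
              Nat.cast_sub (Finset.card_pos.2 hQ)]
            push_cast; ring
          · intro q hq
            simp only [Finset.mem_erase] at hq
            exact hanti j hj q hq.2 (Ne.symm hq.1) c
        rw [e2] at h
        simp only [Pi.neg_apply, Finset.sum_apply]
        linear_combination h
      rw [this]
      refine Submodule.neg_mem _ (Submodule.sum_mem _ fun q hq => ?_)
      simp only [Finset.mem_erase] at hq
      exact BS_cons pt s S j q (hQS hj) hq.2 (Ne.symm hq.1) _ (IH j (hQS hj) q hq.2 (Ne.symm hq.1)
        (Ctr_mem hpt hs hs2 S j q (hQS hj) hq.2 (Ne.symm hq.1) f hf))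
    have hG : ∀ i ∈ S \ Q, (fun c => f c - ∑ j ∈ Q, f (c ∘ Equiv.swap j i)) ∈ BS pt s S := by
      intro i hi
      simp only [Finset.mem_sdiff] at hi
      first
      | exact absurd (Finset.eq_of_subset_of_card_le hQS (by omega)) (fun h => hi.2 (h ▸ hi.1))
      | refine ihd (insert i Q) (Finset.insert_subset hi.1 hQS) (by simp) 
          (by rw [Finset.card_insert_of_notMem hi.2]; omega) _ ?_ ?_
        · have : (fun c => f c - ∑ j ∈ Q, f (c ∘ Equiv.swap j i)) = 
              f - ∑ j ∈ Q, fun c => f (c ∘ Equiv.swap j i) := by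
            ext c; simp
          rw [this]
          exact Submodule.sub_mem _ hf (Submodule.sum_mem _ fun j hj => 
            swap_mem S j i (hQS hj) hi.1 f hf)
        · have A : ∀ a ∈ Q, ∀ c, f ((c ∘ Equiv.swap a i)) - 
              ∑ j ∈ Q, f ((c ∘ Equiv.swap a i) ∘ Equiv.swap j i) =
              - (f c - ∑ j ∈ Q, f (c ∘ Equiv.swap j i)) := by
            intro a ha c
            rw [← Finset.add_sum_erase _ _ ha, ← Finset.add_sum_erase _ _ ha]
            have e1 : (c ∘ Equiv.swap a i) ∘ Equiv.swap a i = c := by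
              ext r; simp
            rw [e1, Finset.sum_congr rfl (s₁ := Q.erase a) 
              (g := fun j => - f (c ∘ Equiv.swap j i)), Finset.sum_neg_distrib]
            · ring
            · intro j hj
              simp only [Finset.mem_erase] at hj
              rw [← hanti j hj.2 a ha hj.1]
              congr 1
              ext r
              simp only [Function.comp, Equiv.swap_apply_def]
              congr 1
              have : i ≠ j := fun h => hi.2 (h ▸ hj.2)
              have : i ≠ a := fun h => hi.2 (h ▸ ha)
              have := hj.1
              grind
          intro a ha b hb hab c
          rw [Finset.mem_insert] at ha hb
          rcases ha with rfl | ha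
          · rcases hb with rfl | hb
            · exact absurd rfl hab
            · rw [Equiv.swap_comm]
              exact A b hb c
          · rcases hb with rfl | hb
            · exact A a ha c
            · rw [hanti a ha b hb hab, neg_sub, sub_eq_add_neg, add_comm, sub_eq_add_neg]
              congr 1
              rw [← Finset.sum_neg_distrib]
              refine Finset.sum_bij' (fun p _ => Equiv.swap a b p) (fun p _ => Equiv.swap a b p) 
                ?_ ?_ (by simp) (by simp) ?_
              · intro p hp
                simp only [Equiv.swap_apply_def]
                split_ifs <;> assumption
              · intro p hp
                simp only [Equiv.swap_apply_def]
                split_ifs <;> assumption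
              · intro j hj
                have := hanti a ha b hb hab (c ∘ Equiv.swap (Equiv.swap a b j) i)
                rw [neg_eq_iff_eq_neg, ← this]
                congr 1
                ext r
                simp only [Function.comp, Equiv.swap_apply_def]
                congr 1
                have : i ≠ j := fun h => hi.2 (h ▸ hj)
                have : i ≠ a := fun h => hi.2 (h ▸ ha)
                have : i ≠ b := fun h => hi.2 (h ▸ hb)
                grind
    have hK : (0 : ℝ) < Q.card * ((Fintype.card X : ℝ) + 2 - Q.card) + (S \ Q).card := by
      have h1 : (Q.card : ℝ) ≤ Fintype.card X := by exact_mod_cast not_lt.1 hbig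
      have h2 : (0 : ℝ) < Q.card := by exact_mod_cast Finset.card_pos.2 hQ
      have h3 : (0 : ℝ) ≤ (S \ Q).card := by positivity
      have : (0 : ℝ) < Q.card * ((Fintype.card X : ℝ) + 2 - Q.card) := mul_pos h2 (by linarith)
      linarith
    have hsum := Submodule.add_mem _ (Submodule.sum_mem _ hR) (Submodule.sum_mem _ hG)
    rw [← Submodule.smul_mem_iff _ hK.ne']
    convert hsum using 1
    ext c
    simp only [Pi.smul_apply, smul_eq_mul, Pi.add_apply, Finset.sum_apply, Finset.sum_add_distrib,
      Finset.sum_sub_distrib, Finset.sum_const, nsmul_eq_mul]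
    rw [Finset.sum_comm]
    ring

theorem fft (hpt : ∀ x, pt (pt x) = x) (hs : ∀ x, s (pt x) = - s x) (hs2 : ∀ x, s x * s x = 1)
    (N : ℕ) : ∀ S : Finset ι, S.card = N → Finite ι → WInv pt s S ≤ BS pt s S := by
  induction N using Nat.strong_induction_on with
  | _ N ih =>
    intro S hS hfin f hf
    rcases S.eq_empty_or_nonempty with rfl | ⟨p, hp⟩
    · have hconst : ∀ c c', f c = f c' := by
        intro c c'
        have := Fintype.ofFinite ι
        have : ∀ T : Finset ι, f (fun i => if i ∈ T then c' i else c i) = f c := by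
          intro T
          induction T using Finset.induction_on with
          | empty => simp
          | insert a T ha hT =>
            rw [← hT, ← hf.1 a (by simp) (fun i => if i ∈ T then c' i else c i) (c' a)]
            congr 1
            ext i
            by_cases h : i = a
            · subst h; simp
            · simp [h]
        have := this Finset.univ
        simpa using this.symm
      by_cases hX : Nonempty (ι → X)
      · obtain ⟨c0⟩ := hX
        have : f = f c0 • (fun _ => 1) := by
          ext c; simp [hconst c c0]
        rw [this]
        exact Submodule.smul_mem _ _ (Submodule.subset_span Gen.nil)
      · have : f = 0 := by
          ext c; exact absurd ⟨c⟩ hX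
        rw [this]; exact Submodule.zero_mem _
    · refine anti_mem hpt hs hs2 S ?_ (S.card - 1) {p} (by simpa using hp) (by simp) ?_ f hf ?_
      · intro a ha b hb hab
        refine ih _ ?_ _ rfl hfin
        rw [← hS]
        exact (Finset.card_le_card (Finset.erase_subset _ _)).trans_lt (Finset.card_erase_lt_of_mem ha)
      · have := Finset.card_pos.2 ⟨p, hp⟩
        simp; omega
      · intro i hi j hj hij
        simp at hi hj
        exact absurd (hi.trans hj.symm) hij
end FFT

section Group
set_option linter.unusedSectionVars false

lemma sum_delta {κ X : Type} [Fintype κ] [DecidableEq κ] [Fintype X] [DecidableEq X]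
    (F : (κ → X) → ℝ) (c : κ → X) (r : κ) :
    ∑ d : κ → X, (∏ q ∈ Finset.univ.erase r, if d q = c q then (1 : ℝ) else 0) * F d =
      ∑ x, F (Function.update c r x) := by
  symm
  refine Finset.sum_of_injOn (fun x => Function.update c r x) ?_ (by simp) ?_ ?_
  · intro x _ y _ h
    have := congrFun h r
    simpa using this
  · intro d _ hd
    have : ∃ q, q ≠ r ∧ d q ≠ c q := by
      by_contra! hcon
      apply hd
      refine ⟨d r, by simp, ?_⟩
      ext q
      by_cases h : q = r
      · subst h; simp
      · simp [h, hcon q h]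
    obtain ⟨q, hq, hdq⟩ := this
    rw [Finset.prod_eq_zero (i := q) (by simp [hq]) (by simp [hdq]), zero_mul]
  · intro x _
    rw [Finset.prod_eq_one, one_mul]
    intro q hq
    simp only [Finset.mem_erase] at hq
    simp [hq.1]

lemma deriv_tensor {κ X : Type} [Fintype κ] [DecidableEq κ] [Fintype X] [DecidableEq X]
    (A : (κ → X) → ℝ) (M : X → X → ℝ) (c : κ → X) :
    HasDerivAt (fun t : ℝ => ∑ d, A d * ∏ r, ((if d r = c r then (1 : ℝ) else 0) + t * M (d r) (c r)))
      (∑ r, ∑ x, M x (c r) * A (Function.update c r x)) 0 := by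
  have h1 : ∀ d : κ → X, HasDerivAt
      (fun t : ℝ => A d * ∏ r, ((if d r = c r then (1 : ℝ) else 0) + t * M (d r) (c r)))
      (A d * ∑ r, (∏ q ∈ Finset.univ.erase r, ((if d q = c q then (1 : ℝ) else 0) + 0 * M (d q) (c q)))
        • M (d r) (c r)) 0 := by
    intro d
    refine HasDerivAt.const_mul _ ?_
    refine HasDerivAt.fun_finsetProd fun r _ => ?_
    have := ((hasDerivAt_id (0 : ℝ)).mul_const (M (d r) (c r))).const_add
      (if d r = c r then (1 : ℝ) else 0)
    simpa using this
  have h2 := HasDerivAt.fun_sum (u := Finset.univ) (fun d _ => h1 d)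
  refine h2.congr_deriv ?_
  simp only [zero_mul, add_zero, smul_eq_mul, Finset.mul_sum]
  rw [Finset.sum_comm]
  refine Finset.sum_congr rfl fun r _ => ?_
  have := sum_delta (fun d => A d * M (d r) (c r)) c r
  rw [Finset.sum_congr rfl (g := fun d => (∏ q ∈ Finset.univ.erase r, if d q = c q then (1 : ℝ) else 0)
    * (A d * M (d r) (c r))) (fun d _ => by ring), this]
  refine Finset.sum_congr rfl fun x _ => ?_
  simp [mul_comm]

variable {m : ℕ}

def ptm (i : Fin (2 * m)) : Fin (2 * m) :=
  ⟨if (i : ℕ) % 2 = 0 then (i : ℕ) + 1 else (i : ℕ) - 1, by have := i.2; split_ifs <;> omega⟩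

def sgm (i : Fin (2 * m)) : ℝ := if (i : ℕ) % 2 = 0 then 1 else -1

lemma ptm_ptm (i : Fin (2 * m)) : ptm (ptm i) = i := by
  ext; simp only [ptm]; split_ifs <;> omega

lemma sgm_ptm (i : Fin (2 * m)) : sgm (ptm i) = - sgm i := by
  simp only [sgm, ptm]; split_ifs <;> first | omega | simp

lemma sgm_sq (i : Fin (2 * m)) : sgm i * sgm i = 1 := by
  simp only [sgm]; split_ifs <;> simp

lemma OmegaM_eq (i j : Fin (2 * m)) : OmegaM (2 * m) i j = Om ptm sgm i j := by
  simp only [OmegaM, Om, sgm, ptm, Matrix.of_apply, Fin.ext_iff]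
  split_ifs <;> first | rfl | omega

lemma OmegaM_skew (i j : Fin (2 * m)) : OmegaM (2 * m) i j = - OmegaM (2 * m) j i := by
  simp only [OmegaM, Matrix.of_apply]
  split_ifs <;> first | omega | simp

lemma OmegaM_transpose : (OmegaM (2 * m))ᵀ = - OmegaM (2 * m) := by
  ext i j; exact OmegaM_skew j i

lemma OmegaM_sq : OmegaM (2 * m) * OmegaM (2 * m) = -1 := by
  ext i j
  simp only [Matrix.mul_apply, OmegaM_eq, Matrix.neg_apply, Matrix.one_apply]
  rw [Finset.sum_eq_single (ptm i)]
  · simp only [Om, if_true, ptm_ptm, sgm_ptm]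
    by_cases h : i = j
    · subst h; simp [sgm_sq]
    · simp [h, Ne.symm h]
  · intro b _ hb
    simp [Om, hb]
  · simp

/-- the symplectic transvection -/
lemma transvection_mem (w : Fin (2 * m) → ℝ) (t : ℝ) :
    (1 + t • vecMulVec w (w ᵥ* OmegaM (2 * m)))ᵀ * OmegaM (2 * m) *
      (1 + t • vecMulVec w (w ᵥ* OmegaM (2 * m))) = OmegaM (2 * m) := by
  have h1 : OmegaM (2 * m) *ᵥ w = - (w ᵥ* OmegaM (2 * m)) := by
    rw [← Matrix.vecMul_transpose, OmegaM_transpose, Matrix.vecMul_neg]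
  have h0 : (w ᵥ* OmegaM (2 * m)) ⬝ᵥ w = 0 := by
    have h2 : (w ᵥ* OmegaM (2 * m)) ⬝ᵥ w = w ⬝ᵥ (OmegaM (2 * m) *ᵥ w) :=
      (Matrix.dotProduct_mulVec w (OmegaM (2 * m)) w).symm
    have h3 := dotProduct_comm w (w ᵥ* OmegaM (2 * m))
    rw [h1, dotProduct_neg] at h2
    linarith
  set η := w ᵥ* OmegaM (2 * m) with hη
  rw [Matrix.transpose_add, Matrix.transpose_one, Matrix.transpose_smul, Matrix.transpose_vecMulVec,
    add_mul, one_mul, Matrix.smul_mul, Matrix.vecMulVec_mul, ← hη, add_mul, mul_add, mul_one,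
    Matrix.mul_smul, Matrix.mul_vecMulVec, h1, mul_add, mul_one, Matrix.smul_mul, Matrix.mul_smul,
    Matrix.vecMulVec_mul_vecMulVec, h0]
  ext i j
  simp [vecMulVec_apply]

lemma lie_equiv {k l : ℕ} (A : Matrix (Fin l → Fin (2 * m)) (Fin k → Fin (2 * m)) ℝ)
    (hA : ∀ g : Matrix (Fin (2 * m)) (Fin (2 * m)) ℝ, gᵀ * OmegaM (2 * m) * g = OmegaM (2 * m) →
      A * tpowM k g = tpowM l g * A) (w : Fin (2 * m) → ℝ) (I : Fin l → Fin (2 * m))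
      (J : Fin k → Fin (2 * m)) :
    ∑ r, ∑ x, w x * (w ᵥ* OmegaM (2 * m)) (J r) * A I (Function.update J r x) =
    ∑ t, ∑ x, w (I t) * (w ᵥ* OmegaM (2 * m)) x * A (Function.update I t x) J := by
  have h1 := deriv_tensor (fun J' => A I J') (fun x y => w x * (w ᵥ* OmegaM (2 * m)) y) J
  have h2 := deriv_tensor (fun I' => A I' J) (fun y x => w x * (w ᵥ* OmegaM (2 * m)) y) I
  refine h1.unique ?_
  refine h2.congr_of_eventuallyEq (Filter.Eventually.of_forall fun t => ?_)
  have := congrFun (congrFun (hA _ (transvection_mem w t)) I) J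
  simp only [Matrix.mul_apply, tpowM, Matrix.of_apply, Matrix.add_apply, Matrix.one_apply,
    Matrix.smul_apply, vecMulVec_apply, smul_eq_mul] at this
  beta_reduce
  rw [this]
  refine Finset.sum_congr rfl fun d _ => ?_
  rw [mul_comm]
  congr 1
  refine Finset.prod_congr rfl fun r _ => ?_
  simp only [eq_comm]

lemma lie_equiv' {k l : ℕ} (A : Matrix (Fin l → Fin (2 * m)) (Fin k → Fin (2 * m)) ℝ)
    (hA : ∀ g : Matrix (Fin (2 * m)) (Fin (2 * m)) ℝ, gᵀ * OmegaM (2 * m) * g = OmegaM (2 * m) →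
      A * tpowM k g = tpowM l g * A) (u v : Fin (2 * m)) (I : Fin l → Fin (2 * m))
      (J : Fin k → Fin (2 * m)) :
    ∑ r, (Om ptm sgm u (J r) * A I (Function.update J r v)
      + Om ptm sgm v (J r) * A I (Function.update J r u)) =
    ∑ t, ((if I t = v then sgm u * A (Function.update I t (ptm u)) J else 0)
      + (if I t = u then sgm v * A (Function.update I t (ptm v)) J else 0)) := by
  have h0 := lie_equiv A hA (Pi.single u 1 + Pi.single v 1) I J
  have h1 := lie_equiv A hA (Pi.single u 1) I J
  have h2 := lie_equiv A hA (Pi.single v 1) I J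
  simp only [Matrix.add_vecMul, Pi.add_apply, add_mul, mul_add, Finset.sum_add_distrib] at h0
  simp only [Matrix.single_one_vecMul, Matrix.row, Pi.single_apply, ite_mul, one_mul, zero_mul,
    Finset.sum_ite_eq', Finset.sum_ite_eq, Finset.mem_univ, if_true, OmegaM_eq] at h0 h1 h2
  have e : ∀ a b, ∑ t, ∑ x, (if I t = a then Om ptm sgm b x * A (Function.update I t x) J else 0)
      = ∑ t, (if I t = a then sgm b * A (Function.update I t (ptm b)) J else 0) := by
    intro a b
    refine Finset.sum_congr rfl fun t _ => ?_
    split_ifs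
    · simp [Om]
    · simp
  rw [Finset.sum_add_distrib, Finset.sum_add_distrib, ← e, ← e]
  linarith

/-- lowering the output indices -/
def lowerT {k l : ℕ} (A : Matrix (Fin l → Fin (2 * m)) (Fin k → Fin (2 * m)) ℝ) :
    (Fin (l + k) → Fin (2 * m)) → ℝ := fun c =>
  (∏ t : Fin l, sgm (c (Fin.castAdd k t))) *
    A (fun t => ptm (c (Fin.castAdd k t))) (fun r => c (Fin.natAdd l r))

lemma lowerT_mem {k l : ℕ} (A : Matrix (Fin l → Fin (2 * m)) (Fin k → Fin (2 * m)) ℝ)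
    (hA : ∀ g : Matrix (Fin (2 * m)) (Fin (2 * m)) ℝ, gᵀ * OmegaM (2 * m) * g = OmegaM (2 * m) →
      A * tpowM k g = tpowM l g * A) : lowerT A ∈ WInv ptm sgm (Finset.univ : Finset (Fin (l + k))) := by
  refine ⟨by simp, fun u v c => ?_⟩
  have h := lie_equiv' A hA u v (fun t => ptm (c (Fin.castAdd k t))) (fun r => c (Fin.natAdd l r))
  rw [Fin.sum_univ_add]
  have eN : ∀ r x, lowerT A (Function.update c (Fin.natAdd l r) x) =
      (∏ t : Fin l, sgm (c (Fin.castAdd k t))) * A (fun t => ptm (c (Fin.castAdd k t)))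
        (Function.update (fun r => c (Fin.natAdd l r)) r x) := by
    intro r x
    unfold lowerT
    have h1 : ∀ t, Function.update c (Fin.natAdd l r) x (Fin.castAdd k t) = c (Fin.castAdd k t) := by
      intro t
      rw [Function.update_of_ne]
      simp only [ne_eq, Fin.ext_iff, Fin.val_castAdd, Fin.val_natAdd]
      omega
    simp only [h1]
    congr 2
    ext q
    simp [Function.update_apply]
  have eC : ∀ t x, lowerT A (Function.update c (Fin.castAdd k t) x) =
      - ((∏ t : Fin l, sgm (c (Fin.castAdd k t))) * (sgm x * sgm (ptm (c (Fin.castAdd k t)))) *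
        A (Function.update (fun t => ptm (c (Fin.castAdd k t))) t (ptm x))
        (fun r => c (Fin.natAdd l r))) := by
    intro t x
    unfold lowerT
    have h1 : ∀ r, Function.update c (Fin.castAdd k t) x (Fin.natAdd l r) = c (Fin.natAdd l r) := by
      intro t
      rw [Function.update_of_ne]
      simp only [ne_eq, Fin.ext_iff, Fin.val_castAdd, Fin.val_natAdd]
      omega
    have h2 : ∀ r, Function.update c (Fin.castAdd k t) x (Fin.castAdd k r) =
        Function.update (fun r => c (Fin.castAdd k r)) t x r := by
      intro r
      simp [Function.update_apply]
    have h3 : (fun r => ptm (Function.update (fun r => c (Fin.castAdd k r)) t x r)) =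
        Function.update (fun t => ptm (c (Fin.castAdd k t))) t (ptm x) := by
      ext r
      by_cases h : r = t
      · subst h; simp
      · simp [h]
    simp only [h1, h2]
    rw [h3, ← Finset.mul_prod_erase _ _ (Finset.mem_univ t),
      ← Finset.mul_prod_erase Finset.univ (fun t => sgm (c (Fin.castAdd k t))) (Finset.mem_univ t),
      Function.update_self]
    rw [Finset.prod_congr rfl (s₁ := Finset.univ.erase t)
      (g := fun t => sgm (c (Fin.castAdd k t)))]
    · rw [sgm_ptm]
      have := sgm_sq (c (Fin.castAdd k t))
      linear_combination (- sgm x * (∏ t ∈ Finset.univ.erase t, sgm (c (Fin.castAdd k t))) *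
        A (Function.update (fun t => ptm (c (Fin.castAdd k t))) t (ptm x))
          (fun r => c (Fin.natAdd l r))) * this
    · intro r hr
      rw [Function.update_of_ne (by simpa using hr)]
  have hN : ∑ r : Fin k, (Om ptm sgm u (c (Fin.natAdd l r)) * lowerT A (Function.update c (Fin.natAdd l r) v)
      + Om ptm sgm v (c (Fin.natAdd l r)) * lowerT A (Function.update c (Fin.natAdd l r) u)) =
      (∏ t : Fin l, sgm (c (Fin.castAdd k t))) * ∑ r, (Om ptm sgm u (c (Fin.natAdd l r)) *
        A (fun t => ptm (c (Fin.castAdd k t))) (Function.update (fun r => c (Fin.natAdd l r)) r v)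
      + Om ptm sgm v (c (Fin.natAdd l r)) *
        A (fun t => ptm (c (Fin.castAdd k t))) (Function.update (fun r => c (Fin.natAdd l r)) r u)) := by
    rw [Finset.mul_sum]
    refine Finset.sum_congr rfl fun r _ => ?_
    rw [eN, eN]; ring
  rw [hN, h, Finset.mul_sum, ← Finset.sum_add_distrib]
  refine Finset.sum_eq_zero fun t _ => ?_
  rw [eC, eC]
  have hO : ∀ a b : Fin (2 * m), Om ptm sgm a b = if ptm b = a then sgm a else 0 := by
    intro a b
    unfold Om
    congr 1
    apply propext
    constructor
    · rintro rfl; exact ptm_ptm _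
    · rintro rfl; exact (ptm_ptm _).symm
  rw [hO, hO]
  have := sgm_sq u
  have := sgm_sq v
  split_ifs with h1 h2 h2
  · rw [← h1, ← h2]
    have := sgm_sq (ptm (c (Fin.castAdd k t)))
    grind
  · rw [h1]; grind
  · rw [h2]; grind
  · simp

end Group

section Final
set_option linter.unusedSectionVars false
variable {m : ℕ}

/-- entry attached to a pair -/
def gam (m l : ℕ) (p q : ℕ) (x y : Fin (2 * m)) : ℝ :=
  if (p < l ↔ q < l) then OmegaM (2 * m) x y else if x = y then (1 : ℝ) else 0

def wgt (l p : ℕ) (x : Fin (2 * m)) : ℝ := if p < l then sgm (ptm x) else 1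

def tau (l p : ℕ) (x : Fin (2 * m)) : Fin (2 * m) := if p < l then ptm x else x

lemma ptm_inj (a b : Fin (2 * m)) : ptm a = ptm b ↔ a = b :=
  ⟨fun h => by rw [← ptm_ptm a, h, ptm_ptm], fun h => by rw [h]⟩

lemma gam_pair (l p q : ℕ) : ∃ e : ℝ, ∀ x y : Fin (2 * m),
    wgt l p x * wgt l q y * Om ptm sgm (tau l p x) (tau l q y) = e * gam m l p q x y := by
  by_cases hp : p < l <;> by_cases hq : q < l
  · refine ⟨1, fun x y => ?_⟩
    simp only [wgt, tau, gam, hp, hq, if_true, OmegaM_eq, Om, ptm_ptm, sgm_ptm]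
    have h1 := sgm_sq x
    by_cases h : y = ptm x
    · subst h
      simp only [ptm_ptm, sgm_ptm, if_true]
      linear_combination sgm x * h1
    · have : ¬ ptm y = x := fun h' => h (by rw [← h', ptm_ptm])
      simp [h, this]
  · refine ⟨1, fun x y => ?_⟩
    simp only [wgt, tau, gam, hp, hq, if_true, if_false, Om, ptm_ptm, sgm_ptm, iff_false, not_true]
    have h1 := sgm_sq x
    by_cases h : x = y
    · subst h
      simp [h1]
    · simp [h, Ne.symm h]
  · refine ⟨-1, fun x y => ?_⟩
    simp only [wgt, tau, gam, hp, hq, if_true, if_false, Om, ptm_ptm, sgm_ptm, iff_true, ptm_inj]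
    have h1 := sgm_sq x
    by_cases h : x = y
    · subst h
      simp [h1]
    · simp [h, Ne.symm h]
  · refine ⟨1, fun x y => ?_⟩
    simp [wgt, tau, gam, hp, hq, OmegaM_eq]

lemma gam_symm (l p q : ℕ) : ∃ e : ℝ, ∀ x y : Fin (2 * m), gam m l p q x y = e * gam m l q p y x := by
  by_cases h : (p < l ↔ q < l)
  · refine ⟨-1, fun x y => ?_⟩
    simp only [gam, h]
    simp [OmegaM_skew x y]
  · refine ⟨1, fun x y => ?_⟩
    have h' : ¬ (q < l ↔ p < l) := fun h2 => h h2.symm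
    simp only [gam, h, h', if_false, one_mul]
    simp only [eq_comm]

lemma Gen_pair {N : ℕ} (l : ℕ) (S : Finset (Fin N)) (h : (Fin N → Fin (2 * m)) → ℝ)
    (hh : Gen ptm sgm S h) : ∃ π : Fin N → Fin N, (∀ p, π (π p) = p) ∧ (∀ p, π p ≠ p ↔ p ∈ S) ∧
      ∃ e : ℝ, ∀ c : Fin N → Fin (2 * m), (∏ p ∈ S, wgt l p (c p)) * h (fun p => tau l p (c p)) =
        e * ∏ p ∈ S.filter (fun p => p < π p), gam m l p (π p) (c p) (c (π p)) := by
  induction hh with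
  | nil => exact ⟨id, by simp, by simp, 1, by simp⟩
  | cons S h p q hp hq hpq hh ih =>
    obtain ⟨π, h1, h2, e, he⟩ := ih
    have hπp : π p = p := by by_contra hc; exact hp ((h2 p).1 hc)
    have hπq : π q = q := by by_contra hc; exact hq ((h2 q).1 hc)
    have hne : ∀ r, r ≠ p → π r ≠ p := fun r hr hc => hr (by rw [← h1 r, hc, hπp])
    have hne' : ∀ r, r ≠ q → π r ≠ q := fun r hr hc => hr (by rw [← h1 r, hc, hπq])
    obtain ⟨e1, he1⟩ := gam_pair (m := m) l p q
    obtain ⟨e2, he2⟩ := gam_symm (m := m) l p q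
    let π' : Fin N → Fin N := fun r => if r = p then q else if r = q then p else π r
    have hπ'p : π' p = q := by simp [π']
    have hπ'q : π' q = p := by simp [π', hpq.symm]
    have hπ'r : ∀ r ∈ S, π' r = π r := by
      intro r hr
      have a1 : r ≠ p := fun h => hp (h ▸ hr)
      have a2 : r ≠ q := fun h => hq (h ▸ hr)
      simp [π', a1, a2]
    have hS : ∀ c : Fin N → Fin (2 * m),
        ∏ r ∈ S.filter (fun r => r < π' r), gam m l r (π' r) (c r) (c (π' r)) =
        ∏ r ∈ S.filter (fun r => r < π r), gam m l r (π r) (c r) (c (π r)) := by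
      intro c
      have : S.filter (fun r => r < π' r) = S.filter (fun r => r < π r) :=
        Finset.filter_congr fun r hr => by rw [hπ'r r hr]
      rw [this]
      refine Finset.prod_congr rfl fun r hr => ?_
      rw [hπ'r r (Finset.mem_filter.1 hr).1]
    have hqS : q ∉ S := hq
    have hpS : p ∉ insert q S := by simp [hpq, hp]
    refine ⟨π', ?_, ?_, ?_⟩
    · intro r
      by_cases a1 : r = p
      · subst a1; rw [hπ'p, hπ'q]
      by_cases a2 : r = q
      · subst a2; rw [hπ'q, hπ'p]
      simp [π', a1, a2, hne r a1, hne' r a2, h1]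
    · intro r
      by_cases a1 : r = p
      · subst a1; simp [hπ'p, hpq.symm]
      by_cases a2 : r = q
      · subst a2; simp [hπ'q, hpq]
      simp [π', a1, a2, h2]
    · rcases lt_or_gt_of_ne hpq with hlt | hlt
      · refine ⟨e1 * e, fun c => ?_⟩
        rw [Finset.prod_insert hpS, Finset.prod_insert hqS, Finset.filter_insert, hπ'p, if_pos hlt,
          Finset.filter_insert, hπ'q, if_neg (not_lt.2 hlt.le), Finset.prod_insert (by simp [hp]),
          hS, hπ'p]
        linear_combination (∏ p ∈ S, wgt l p (c p)) * h (fun p => tau l p (c p)) * he1 (c p) (c q)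
          + e1 * gam m l p q (c p) (c q) * he c
      · refine ⟨e1 * e2 * e, fun c => ?_⟩
        rw [Finset.prod_insert hpS, Finset.prod_insert hqS, Finset.filter_insert, hπ'p,
          if_neg (not_lt.2 hlt.le), Finset.filter_insert, hπ'q, if_pos hlt,
          Finset.prod_insert (by simp [hq]), hS, hπ'q]
        linear_combination (∏ p ∈ S, wgt l p (c p)) * h (fun p => tau l p (c p)) * he1 (c p) (c q)
          + e1 * gam m l p q (c p) (c q) * he c + e1 * e *
          (∏ r ∈ S.filter (fun r => r < π r), gam m l r (π r) (c r) (c (π r))) * he2 (c p) (c q)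

/-- raising the output indices -/
def raiseT (k l : ℕ) : ((Fin (l + k) → Fin (2 * m)) → ℝ) →ₗ[ℝ]
    Matrix (Fin l → Fin (2 * m)) (Fin k → Fin (2 * m)) ℝ where
  toFun f := Matrix.of fun I J => (∏ p : Fin (l + k), wgt l p (Fin.append I J p)) *
    f (fun p => tau l p (Fin.append I J p))
  map_add' f g := by ext I J; simp [mul_add]
  map_smul' a f := by ext I J; simp only [Matrix.of_apply, Matrix.smul_apply, Pi.smul_apply,
    smul_eq_mul, RingHom.id_apply]; ring

lemma raise_lower {k l : ℕ} (A : Matrix (Fin l → Fin (2 * m)) (Fin k → Fin (2 * m)) ℝ) :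
    raiseT k l (lowerT A) = A := by
  ext I J
  simp only [raiseT, lowerT, LinearMap.coe_mk, AddHom.coe_mk, Matrix.of_apply, Fin.prod_univ_add,
    wgt, tau, Fin.append_left, Fin.append_right, Fin.val_castAdd, Fin.val_natAdd, Fin.is_lt, if_true,
    not_lt, Nat.le_add_right, ptm_ptm]
  have : ∀ i : Fin k, ¬ (l + (i : ℕ) < l) := by intro i; omega
  simp only [this, if_false, Finset.prod_const_one, mul_one]
  rw [← mul_assoc, ← Finset.prod_mul_distrib]
  simp [sgm_sq]

lemma brauer_apply {k l : ℕ} (β : BrauerPairing (l + k)) (I : Fin l → Fin (2 * m))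
    (J : Fin k → Fin (2 * m)) : sympBrauerMatrix (2 * m) k l β I J =
    ∏ p ∈ Finset.univ.filter (fun p => p < β.pair p),
      gam m l p (β.pair p) (Fin.append I J p) (Fin.append I J (β.pair p)) := rfl

lemma raise_mem {k l : ℕ} (f : (Fin (l + k) → Fin (2 * m)) → ℝ)
    (hf : f ∈ BS ptm sgm (Finset.univ : Finset (Fin (l + k)))) :
    raiseT k l f ∈ Submodule.span ℝ (Set.range fun β : BrauerPairing (l + k) =>
      sympBrauerMatrix (2 * m) k l β) := by
  induction hf using Submodule.span_induction with
  | mem h hh =>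
    obtain ⟨π, h1, h2, e, he⟩ := Gen_pair l _ h hh
    let β : BrauerPairing (l + k) := ⟨π, h1, fun p => (h2 p).2 (Finset.mem_univ p)⟩
    have : raiseT k l h = e • sympBrauerMatrix (2 * m) k l β := by
      ext I J
      rw [Matrix.smul_apply, brauer_apply, smul_eq_mul]
      exact he (Fin.append I J)
    rw [this]
    exact Submodule.smul_mem _ _ (Submodule.subset_span ⟨β, rfl⟩)
  | zero => rw [map_zero]; exact Submodule.zero_mem _
  | add x y _ _ hx hy => rw [map_add]; exact Submodule.add_mem _ hx hy
  | smul a x _ hx => rw [map_smul]; exact Submodule.smul_mem _ _ hx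

lemma sum_matching {N : ℕ} {X : Type} [Fintype X] [DecidableEq X] (β : BrauerPairing N)
    (M : Fin N → X → ℝ) (G : Fin N → X → X → ℝ) :
    ∑ d : Fin N → X, (∏ p, M p (d p)) *
      ∏ p ∈ Finset.univ.filter (fun p => p < β.pair p), G p (d p) (d (β.pair p)) =
    ∏ p ∈ Finset.univ.filter (fun p => p < β.pair p),
      ∑ z : X × X, M p z.1 * M (β.pair p) z.2 * G p z.1 z.2 := by
  have h1 : ∀ d : Fin N → X, ∏ p, M p (d p) =
      ∏ p ∈ Finset.univ.filter (fun p => p < β.pair p),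
        M p (d p) * M (β.pair p) (d (β.pair p)) := by
    intro d
    rw [← Finset.prod_filter_mul_prod_filter_not Finset.univ (fun p => p < β.pair p),
      Finset.prod_mul_distrib]
    congr 1
    refine Finset.prod_bij' (fun p _ => β.pair p) (fun p _ => β.pair p) ?_ ?_
      (by simp [β.invol]) (by simp [β.invol]) (by simp [β.invol])
    · intro p hp
      simp only [Finset.mem_filter, Finset.mem_univ, true_and, β.invol] at hp ⊢
      exact lt_of_le_of_ne (not_lt.1 hp) (β.ne p)
    · intro p hp
      simp only [Finset.mem_filter, Finset.mem_univ, true_and, β.invol] at hp ⊢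
      exact not_lt.2 hp.le
  simp only [h1, ← Finset.prod_mul_distrib]
  rw [Finset.prod_subtype (p := fun p => p < β.pair p) _ (by simp)]
  rw [Finset.prod_univ_sum, Fintype.piFinset_univ]
  refine Fintype.sum_equiv
    { toFun := fun d p => (d p.1, d (β.pair p.1))
      invFun := fun e q => if h : q < β.pair q then (e ⟨q, h⟩).1 else
        (e ⟨β.pair q, by rw [β.invol]; exact lt_of_le_of_ne (not_lt.1 h) (β.ne q)⟩).2
      left_inv := ?_
      right_inv := ?_ } _ _ ?_
  · intro d
    ext q
    by_cases h : q < β.pair q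
    · simp [h]
    · simp [h, β.invol]
  · intro e
    ext1 ⟨p, hp⟩
    have : ¬ (β.pair p < p) := not_lt.2 hp.le
    ext
    · simp [hp]
    · simp [β.invol, this]
  · intro d
    rw [Finset.prod_subtype (p := fun p => p < β.pair p) _ (by simp)]
    rfl

lemma sp_transpose (g : Matrix (Fin (2 * m)) (Fin (2 * m)) ℝ)
    (hg : gᵀ * OmegaM (2 * m) * g = OmegaM (2 * m)) : g * OmegaM (2 * m) * gᵀ = OmegaM (2 * m) := by
  have h1 : (- (OmegaM (2 * m) * gᵀ * OmegaM (2 * m))) * g = 1 := by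
    rw [neg_mul, mul_assoc, mul_assoc, ← mul_assoc gᵀ, hg, OmegaM_sq, neg_neg]
  have h2 := mul_eq_one_comm.1 h1
  have h3 := congrArg (· * OmegaM (2 * m)) h2
  simp only [one_mul, mul_neg, neg_mul] at h3
  have h4 : g * (OmegaM (2 * m) * gᵀ * OmegaM (2 * m)) * OmegaM (2 * m) =
      - (g * OmegaM (2 * m) * gᵀ) := by
    simp only [mul_assoc, OmegaM_sq]
    simp
  rw [h4, neg_neg] at h3
  exact h3

lemma sum_append {k l : ℕ} {X : Type} [Fintype X] (F : (Fin (l + k) → X) → ℝ) :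
    ∑ d, F d = ∑ I : Fin l → X, ∑ J : Fin k → X, F (Fin.append I J) := by
  rw [← Fintype.sum_prod_type']
  exact (Fintype.sum_equiv (Fin.appendEquiv l k) _ _ (fun _ => rfl)).symm

lemma brauer_equiv {k l : ℕ} (β : BrauerPairing (l + k)) (g : Matrix (Fin (2 * m)) (Fin (2 * m)) ℝ)
    (hg : gᵀ * OmegaM (2 * m) * g = OmegaM (2 * m)) :
    sympBrauerMatrix (2 * m) k l β * tpowM k g = tpowM l g * sympBrauerMatrix (2 * m) k l β := by
  have hg' := sp_transpose g hg
  ext I J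
  have hk : ∀ i : Fin k, ¬ (l + (i : ℕ) < l) := by intro i; omega
  have hL : (sympBrauerMatrix (2 * m) k l β * tpowM k g) I J =
      ∑ d : Fin (l + k) → Fin (2 * m), (∏ p : Fin (l + k), (if (p : ℕ) < l then
        (if d p = Fin.append I J p then (1 : ℝ) else 0) else g (d p) (Fin.append I J p))) *
      ∏ p ∈ Finset.univ.filter (fun p => p < β.pair p),
        gam m l p (β.pair p) (d p) (d (β.pair p)) := by
    rw [sum_append, Finset.sum_eq_single I]
    · rw [Matrix.mul_apply]
      refine Finset.sum_congr rfl fun J' _ => ?_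
      rw [← brauer_apply, mul_comm, Fin.prod_univ_add]
      simp [hk, tpowM]
    · intro I' _ hI
      obtain ⟨t, ht⟩ := Function.ne_iff.1 hI
      refine Finset.sum_eq_zero fun J' _ => ?_
      rw [Finset.prod_eq_zero (i := Fin.castAdd k t) (by simp) (by simp [ht]), zero_mul]
    · simp
  have hR : (tpowM l g * sympBrauerMatrix (2 * m) k l β) I J =
      ∑ d : Fin (l + k) → Fin (2 * m), (∏ p : Fin (l + k), (if (p : ℕ) < l then
        g (Fin.append I J p) (d p) else (if d p = Fin.append I J p then (1 : ℝ) else 0))) *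
      ∏ p ∈ Finset.univ.filter (fun p => p < β.pair p),
        gam m l p (β.pair p) (d p) (d (β.pair p)) := by
    rw [sum_append, Matrix.mul_apply]
    refine Finset.sum_congr rfl fun I' _ => ?_
    rw [Finset.sum_eq_single J]
    · rw [← brauer_apply, Fin.prod_univ_add]
      simp [hk, tpowM]
    · intro J' _ hI
      obtain ⟨t, ht⟩ := Function.ne_iff.1 hI
      rw [Finset.prod_eq_zero (i := Fin.natAdd l t) (by simp) (by simp [ht]), zero_mul]
    · simp
  rw [hL, hR]
  rw [sum_matching β (fun p x => if (p : ℕ) < l then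
        (if x = Fin.append I J p then (1 : ℝ) else 0) else g x (Fin.append I J p))
        (fun p x y => gam m l p (β.pair p) x y),
    sum_matching β (fun p x => if (p : ℕ) < l then
        g (Fin.append I J p) x else (if x = Fin.append I J p then (1 : ℝ) else 0))
        (fun p x y => gam m l p (β.pair p) x y)]
  refine Finset.prod_congr rfl fun p hp => ?_
  have hlt : (p : ℕ) < (β.pair p : ℕ) := (Finset.mem_filter.1 hp).2
  generalize β.pair p = q at hlt ⊢
  generalize Fin.append I J p = a
  generalize Fin.append I J q = b
  rw [Fintype.sum_prod_type, Fintype.sum_prod_type]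
  have e1 : ∑ x, ∑ y, g a x * g b y * OmegaM (2 * m) x y = OmegaM (2 * m) a b := by
    conv_rhs => rw [← hg']
    simp only [Matrix.mul_apply, Matrix.transpose_apply, Finset.sum_mul]
    rw [Finset.sum_comm]
    exact Finset.sum_congr rfl fun x _ => Finset.sum_congr rfl fun y _ => by ring
  have e2 : ∑ x, ∑ y, g x a * g y b * OmegaM (2 * m) x y = OmegaM (2 * m) a b := by
    conv_rhs => rw [← hg]
    simp only [Matrix.mul_apply, Matrix.transpose_apply, Finset.sum_mul]
    rw [Finset.sum_comm]
    exact Finset.sum_congr rfl fun x _ => Finset.sum_congr rfl fun y _ => by ring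
  by_cases h1 : (p : ℕ) < l <;> by_cases h2 : (q : ℕ) < l
  · simp only [h1, h2, if_true, gam, e1]
    simp
  · simp only [h1, h2, if_true, if_false, gam, iff_false, not_true]
    simp
  · omega
  · simp only [h1, h2, if_false, gam, if_true, e2]
    simp

lemma BrauerPairing_ext {N : ℕ} {a b : BrauerPairing N} (h : a.pair = b.pair) : a = b := by
  cases a; cases b; cases h; rfl

lemma BrauerPairing_card {N : ℕ} (hN : Even N) :
    Finite (BrauerPairing N) ∧ Nat.card (BrauerPairing N) ≤ Nat.doubleFactorial (N - 1) := by
  obtain ⟨r, rfl⟩ := hN.two_dvd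
  let T : Finset (Equiv.Perm (Fin (2 * r))) :=
    Finset.univ.filter fun σ => σ.cycleType = Multiset.replicate r 2
  have hmem : ∀ β : BrauerPairing (2 * r), Function.Involutive.toPerm β.pair β.invol ∈ T := by
    intro β
    set σ := Function.Involutive.toPerm β.pair β.invol with hσ
    simp only [T, Finset.mem_filter, Finset.mem_univ, true_and]
    have hap : ∀ p, σ p = β.pair p := fun _ => rfl
    have hinv : ∀ p, β.pair (β.pair p) = p := fun p => β.invol p
    have h2 : σ ^ 2 = 1 := by
      ext p; simp [pow_two, hap, hinv]
    have hall : ∀ n ∈ σ.cycleType, n = 2 := by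
      intro n hn
      have a1 := Equiv.Perm.two_le_of_mem_cycleType hn
      have a2 := (Equiv.Perm.dvd_of_mem_cycleType hn).trans (orderOf_dvd_of_pow_eq_one h2)
      have := Nat.le_of_dvd (by norm_num) a2
      omega
    have hrep := Multiset.eq_replicate_card.2 hall
    have hsum := Equiv.Perm.sum_cycleType σ
    have hsup : σ.support = Finset.univ := by
      ext p; simp [hap, β.ne]
    rw [hsup, hrep, Multiset.sum_replicate, Finset.card_univ, Fintype.card_fin, smul_eq_mul] at hsum
    rw [hrep, (by omega : Multiset.card σ.cycleType = r)]
  let F : BrauerPairing (2 * r) → T := fun β => ⟨_, hmem β⟩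
  have hF : Function.Injective F := by
    intro a b hab
    apply BrauerPairing_ext
    ext1 p
    have := congrArg (fun s : T => s.1 p) hab
    exact this
  refine ⟨Finite.of_injective F hF, ?_⟩
  have hle := Nat.card_le_card_of_injective F hF
  refine hle.trans ?_
  have hT : Nat.card T = T.card := by simp
  rw [hT]
  have hc := Equiv.Perm.card_of_cycleType (Fin (2 * r)) (Multiset.replicate r 2)
  rw [if_pos ⟨by simp [mul_comm], fun a ha => (Multiset.eq_of_mem_replicate ha).ge⟩] at hc
  refine hc.le.trans ?_
  rcases r with _ | r
  · simp
  have hd : (2 * (r + 1)).factorial = 2 ^ (r + 1) * (r + 1).factorial *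
      Nat.doubleFactorial (2 * (r + 1) - 1) := by
    rw [← Nat.doubleFactorial_two_mul]
    exact Nat.factorial_eq_mul_doubleFactorial (2 * r + 1)
  apply Nat.div_le_of_le_mul
  rw [Fintype.card_fin, hd]
  apply Nat.mul_le_mul_right
  apply le_of_eq
  rw [Multiset.sum_replicate, Multiset.prod_replicate, Multiset.toFinset_replicate,
    if_neg (Nat.succ_ne_zero r), Finset.prod_singleton, Multiset.count_replicate_self,
    smul_eq_mul, mul_comm (r + 1) 2, Nat.sub_self, Nat.factorial_zero, one_mul]

end Final

/-- For `n = 2m` and `l + k` even, the maps `F_β` (over all `(k,l)`-Brauer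
partitions `β`) span `Hom_{Sp(n)}((ℝⁿ)^{⊗k}, (ℝⁿ)^{⊗l})`; in particular the
dimension of this space is at most `(l + k - 1)!!`. -/
theorem stmt6 (n m k l : ℕ) (hm : 1 ≤ m) (hn : n = 2 * m) (heven : Even (l + k)) :
    Submodule.span ℝ
      {φ : ((Fin k → Fin n) → ℝ) →ₗ[ℝ] ((Fin l → Fin n) → ℝ) |
        ∃ β : BrauerPairing (l + k), φ = (sympBrauerMatrix n k l β).mulVecLin}
      = EquivSub k l (fun g => gᵀ * OmegaM n * g = OmegaM n) ∧
    Module.finrank ℝ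
        (EquivSub (n := n) k l (fun g => gᵀ * OmegaM n * g = OmegaM n)) ≤
      Nat.doubleFactorial (l + k - 1) := by
  subst hn
  have hset : {φ : ((Fin k → Fin (2 * m)) → ℝ) →ₗ[ℝ] ((Fin l → Fin (2 * m)) → ℝ) |
        ∃ β : BrauerPairing (l + k), φ = (sympBrauerMatrix (2 * m) k l β).mulVecLin} =
      Set.range (fun β : BrauerPairing (l + k) => (sympBrauerMatrix (2 * m) k l β).mulVecLin) := by
    ext φ; simp [eq_comm]
  have hmain : Submodule.span ℝ
      {φ : ((Fin k → Fin (2 * m)) → ℝ) →ₗ[ℝ] ((Fin l → Fin (2 * m)) → ℝ) |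
        ∃ β : BrauerPairing (l + k), φ = (sympBrauerMatrix (2 * m) k l β).mulVecLin}
      = EquivSub k l (fun g => gᵀ * OmegaM (2 * m) * g = OmegaM (2 * m)) := by
    apply le_antisymm
    · rw [Submodule.span_le]
      rintro φ ⟨β, rfl⟩ g hg
      rw [← Matrix.mulVecLin_mul, ← Matrix.mulVecLin_mul, brauer_equiv β g hg]
    · intro φ hφ
      have hA : ∀ g : Matrix (Fin (2 * m)) (Fin (2 * m)) ℝ,
          gᵀ * OmegaM (2 * m) * g = OmegaM (2 * m) →
          LinearMap.toMatrix' φ * tpowM k g = tpowM l g * LinearMap.toMatrix' φ := by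
        intro g hg
        have h := congrArg LinearMap.toMatrix' (hφ g hg)
        simp only [LinearMap.toMatrix'_comp, ← Matrix.toLin'_apply',
          LinearMap.toMatrix'_toLin'] at h
        exact h
      have h1 := fft ptm_ptm sgm_ptm sgm_sq _ (Finset.univ : Finset (Fin (l + k))) rfl inferInstance
        (lowerT_mem _ hA)
      have h2 := raise_mem _ h1
      rw [raise_lower] at h2
      have h3 := Submodule.mem_map_of_mem
        (f := (Matrix.toLin' (R := ℝ) (m := Fin l → Fin (2 * m)) (n := Fin k → Fin (2 * m))).toLinearMap) h2
      rw [Submodule.map_span, ← Set.range_comp] at h3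
      rw [hset]
      have e : Matrix.toLin' (LinearMap.toMatrix' φ) = φ := Matrix.toLin'_toMatrix' φ
      have h4 : Matrix.toLin' (LinearMap.toMatrix' φ) ∈ Submodule.span ℝ
          (Set.range fun β : BrauerPairing (l + k) =>
            (sympBrauerMatrix (2 * m) k l β).mulVecLin) := h3
      rwa [e] at h4
  refine ⟨hmain, ?_⟩
  obtain ⟨hfin, hcard⟩ := BrauerPairing_card heven
  have := Fintype.ofFinite (BrauerPairing (l + k))
  rw [← hmain, hset]
  refine (finrank_range_le_card _).trans ?_
  rwa [← Nat.card_eq_fintype_card]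
end
end
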